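/- Let f : ℝⁿ → ℝ ∪ {+∞} be a proper lower semicontinuous function that is both prox-regular and subdifferentially continuous at x̄ for 0 ∈ ∂f(x̄). Then the following conditions are equivalent, and each of them holds if and only if x̄ is a tilt-stable local minimizer of f: (a) the subgradient mapping ∂f : ℝⁿ ⇉ ℝⁿ is metrically regular around (x̄, 0) and the generalized Hessian ∂²f(x̄, 0) is positive-semidefinite, i.e., ⟨u*, u⟩ ≥ 0 whenever u* ∈ ∂²f(x̄, 0)(u) and u ≠ 0; (b) ∂f is strongly metrically regular around (x̄, 0) and x̄ is a local minimizer of f; (c) ∂²f(x̄, 0) is positive-definite, i.e., ⟨u*, u⟩ > 0 whenever u* ∈ ∂²f(x̄, 0)(u) and u ≠ 0; (d) Ker ∂²f(x̄, 0) = {0}, where Ker ∂²f(x̄, 0) = {u ∈ ℝⁿ : 0 ∈ ∂²f(x̄, 0)(u)}, and ∂²f(x̄, 0) is positive-semidefinite. -/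

import Mathlib

open Filter Metric Topology RealInnerProductSpace

noncomputable section

variable {X : Type*} [NormedAddCommGroup X] [InnerProductSpace ℝ X]

/-- The regular/Fréchet subdifferential of `f` at `x`. -/
def FrechetSubdiff (f : X → EReal) (x : X) : Set X :=
  {p | f x ≠ ⊤ ∧ ∀ ε : ℝ, 0 < ε → ∃ δ : ℝ, 0 < δ ∧
    ∀ y : X, ‖y - x‖ < δ → f x + ((⟪p, y - x⟫ - ε * ‖y - x‖ : ℝ) : EReal) ≤ f y}

/-- The limiting subdifferential of `f` at `x`: outer limit (in norm) of
Fréchet subdifferentials. -/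
def LimitingSubdiff (f : X → EReal) (x : X) : Set X :=
  {p | ∃ (xs ps : ℕ → X),
    (∀ k, ps k ∈ FrechetSubdiff f (xs k)) ∧
    Tendsto xs atTop (𝓝 x) ∧
    Tendsto (fun k => f (xs k)) atTop (𝓝 (f x)) ∧
    Tendsto ps atTop (𝓝 p)}

def MetricallySubregularAt {A B : Type*} [PseudoMetricSpace A] [PseudoMetricSpace B]
    (F : A → Set B) (xb : A) (yb : B) (κ : ℝ) : Prop :=
  ∃ U ∈ 𝓝 xb, ∀ x ∈ U,
    EMetric.infEdist x {z | yb ∈ F z} ≤ ENNReal.ofReal κ * EMetric.infEdist yb (F x)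

def StronglyMetricallySubregularAt {A B : Type*} [PseudoMetricSpace A] [PseudoMetricSpace B]
    (F : A → Set B) (xb : A) (yb : B) (κ : ℝ) : Prop :=
  ∃ U ∈ 𝓝 xb, (∀ x ∈ U,
    EMetric.infEdist x {z | yb ∈ F z} ≤ ENNReal.ofReal κ * EMetric.infEdist yb (F x)) ∧
    {z | yb ∈ F z} ∩ U = {xb}

def MetricallyRegularAround {A B : Type*} [PseudoMetricSpace A] [PseudoMetricSpace B]
    (F : A → Set B) (xb : A) (yb : B) (κ : ℝ) : Prop :=
  ∃ U ∈ 𝓝 xb, ∃ V ∈ 𝓝 yb, ∀ x ∈ U, ∀ y ∈ V,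
    EMetric.infEdist x {z | y ∈ F z} ≤ ENNReal.ofReal κ * EMetric.infEdist y (F x)

def StronglyMetricallyRegularAround {A B : Type*} [PseudoMetricSpace A] [PseudoMetricSpace B]
    (F : A → Set B) (xb : A) (yb : B) (κ : ℝ) : Prop :=
  MetricallyRegularAround F xb yb κ ∧
  ∃ V ∈ 𝓝 yb, ∃ U ∈ 𝓝 xb, ∀ y ∈ V, ∃! x, x ∈ U ∧ y ∈ F x

/-- `f` is subdifferentially continuous at `xb` for `pb`: the map `(x, p) ↦ f x` is
continuous at `(xb, pb)` relative to the graph of the limiting subdifferential. -/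
def SubdiffContAt (f : X → EReal) (xb pb : X) : Prop :=
  Tendsto (fun q : X × X => f q.1)
    (𝓝[{q : X × X | q.2 ∈ LimitingSubdiff f q.1}] (xb, pb)) (𝓝 (f xb))

/-- `f` is prox-regular at `xb` for `pb`. -/
def ProxRegularAt (f : X → EReal) (xb pb : X) : Prop :=
  f xb ≠ ⊤ ∧ ∃ r : ℝ, 0 < r ∧ ∃ ε : ℝ, 0 < ε ∧
    ∀ x ∈ Metric.closedBall xb ε, ∀ u ∈ Metric.closedBall xb ε,
      f u ≤ f xb + (ε : EReal) → f xb ≤ f u + (ε : EReal) →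
      ∀ p ∈ LimitingSubdiff f u, p ∈ Metric.closedBall pb ε →
        f u + ((⟪p, x - u⟫ - r / 2 * ‖x - u‖ ^ 2 : ℝ) : EReal) ≤ f x

/-- The set of minimizers of the tilted function `x ↦ f x - ⟪p, x⟫` over the
closed ball of radius `γ` around `xb`. -/
def TiltArgmin (f : X → EReal) (xb : X) (γ : ℝ) (p : X) : Set X :=
  {x | x ∈ Metric.closedBall xb γ ∧ ∀ y ∈ Metric.closedBall xb γ,
    f x - ((⟪p, x⟫ : ℝ) : EReal) ≤ f y - ((⟪p, y⟫ : ℝ) : EReal)}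

/-- `xb` is a tilt-stable local minimizer of `f` with modulus `κ`. -/
def TiltStableWith (f : X → EReal) (xb : X) (κ : ℝ) : Prop :=
  ∃ γ : ℝ, 0 < γ ∧ ∃ V ∈ 𝓝 (0 : X), ∃ m : X → X,
    (∀ p ∈ V, TiltArgmin f xb γ p = {m p}) ∧
    LipschitzOnWith (Real.toNNReal κ) m V ∧ m 0 = xb

/-- `xb` is a tilt-stable local minimizer of `f`. -/
def TiltStable (f : X → EReal) (xb : X) : Prop :=
  ∃ γ : ℝ, 0 < γ ∧ ∃ V ∈ 𝓝 (0 : X), ∃ m : X → X, ∃ K : NNReal,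
    (∀ p ∈ V, TiltArgmin f xb γ p = {m p}) ∧
    LipschitzOnWith K m V ∧ m 0 = xb

/-- The Fréchet/regular normal cone to a subset of `X × X` at a point. -/
def FrechetNormalP (Ω : Set (X × X)) (zb : X × X) : Set (X × X) :=
  {w | ∀ ε : ℝ, 0 < ε → ∃ δ : ℝ, 0 < δ ∧ ∀ z ∈ Ω, dist z zb < δ →
    ⟪w.1, z.1 - zb.1⟫ + ⟪w.2, z.2 - zb.2⟫ ≤ ε * dist z zb}

/-- The combined second-order subdifferential of `f` at `x` for `p ∈ ∂f(x)`:
the regular coderivative of the limiting subdifferential mapping. -/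
def CombinedSecondSubdiff (f : X → EReal) (x p u : X) : Set X :=
  {w | (w, -u) ∈ FrechetNormalP {q : X × X | q.2 ∈ LimitingSubdiff f q.1} (x, p)}

/-- The limiting/Mordukhovich normal cone to a subset of `X × X` at a point. -/
def LimitingNormalP (Ω : Set (X × X)) (zb : X × X) : Set (X × X) :=
  {w | ∃ (zs ws : ℕ → X × X),
    (∀ k, zs k ∈ Ω ∧ ws k ∈ FrechetNormalP Ω (zs k)) ∧
    Tendsto zs atTop (𝓝 zb) ∧ Tendsto ws atTop (𝓝 w)}

/-- The second-order subdifferential (generalized Hessian) of `f` at `xb` for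
`pb ∈ ∂f(xb)`: the limiting coderivative of the limiting subdifferential mapping. -/
def SecondSubdiff (f : X → EReal) (xb pb u : X) : Set X :=
  {w | (w, -u) ∈ LimitingNormalP {q : X × X | q.2 ∈ LimitingSubdiff f q.1} (xb, pb)}


/-! ### Auxiliary lemmas -/

/-- Real-valued version of a Fréchet subgradient via a quadratic minorant. -/
theorem aux_mem_subdiff {f : X → EReal} (hbot : ∀ x, f x ≠ ⊥) {x p : X} {δ C : ℝ} (hδ : 0 < δ)
    (hx : f x ≠ ⊤)
    (h : ∀ y, ‖y - x‖ < δ → f y ≠ ⊤ →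
      (f x).toReal + ⟪p, y - x⟫ - C * ‖y - x‖ ^ 2 ≤ (f y).toReal) :
    p ∈ LimitingSubdiff f x := by
  refine ⟨fun _ => x, fun _ => p, fun _ => ⟨hx, ?_⟩, tendsto_const_nhds, tendsto_const_nhds,
    tendsto_const_nhds⟩
  intro ε hε
  refine ⟨min δ (ε / (|C| + 1)), by positivity, ?_⟩
  intro y hy
  by_cases hyt : f y = ⊤
  · rw [hyt]; exact le_top
  have h1 := h y (lt_of_lt_of_le hy (min_le_left _ _)) hyt
  have h2 := lt_of_lt_of_le hy (min_le_right _ _)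
  rw [lt_div_iff₀ (by positivity)] at h2
  have h3 : C * ‖y - x‖ ^ 2 ≤ ε * ‖y - x‖ := by
    have h4 : C ≤ |C| := le_abs_self C
    have h5 := norm_nonneg (y - x)
    have h6 : C * ‖y - x‖ ≤ ε := by nlinarith
    nlinarith
  rw [← EReal.coe_toReal hx (hbot x), ← EReal.coe_toReal hyt (hbot y), ← EReal.coe_add,
    EReal.coe_le_coe_iff]
  linarith

/-- Existence of minimizers for continuous perturbations of an lsc function on compact sets. -/
theorem aux_exists_min {f : X → EReal} (hbot : ∀ x, f x ≠ ⊥) (hlsc : LowerSemicontinuous f)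
    {S : Set X} (hS : IsCompact S) {x0 : X} (hx0 : x0 ∈ S) (hfx0 : f x0 ≠ ⊤)
    (φ : X → ℝ) (hφ : Continuous φ) :
    ∃ x ∈ S, f x ≠ ⊤ ∧ ∀ y ∈ S, f y ≠ ⊤ → (f x).toReal + φ x ≤ (f y).toReal + φ y := by
  have hl : LowerSemicontinuous (fun x => f x + ((φ x : ℝ) : EReal)) := by
    refine LowerSemicontinuous.add' hlsc
      (continuous_coe_real_ereal.comp hφ).lowerSemicontinuous ?_
    intro x
    exact EReal.continuousAt_add (Or.inr (EReal.coe_ne_bot _)) (Or.inr (EReal.coe_ne_top _))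
  obtain ⟨x, hxS, hx⟩ := (hl.lowerSemicontinuousOn S).exists_isMinOn ⟨x0, hx0⟩ hS
  have key : ∀ y ∈ S, f x + ((φ x : ℝ) : EReal) ≤ f y + ((φ y : ℝ) : EReal) := fun y hy => hx hy
  have hxt : f x ≠ ⊤ := by
    intro ht
    have := key x0 hx0
    rw [ht, ← EReal.coe_toReal hfx0 (hbot x0), ← EReal.coe_add, EReal.top_add_coe] at this
    exact absurd (top_le_iff.1 this) (EReal.coe_ne_top _)
  refine ⟨x, hxS, hxt, fun y hy hyt => ?_⟩
  have := key y hy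
  rw [← EReal.coe_toReal hxt (hbot x), ← EReal.coe_toReal hyt (hbot y), ← EReal.coe_add,
    ← EReal.coe_add, EReal.coe_le_coe_iff] at this
  exact this

theorem aux_mem_tilt {f : X → EReal} (hbot : ∀ x, f x ≠ ⊥) {xb : X} (hxb : f xb ≠ ⊤)
    {γ : ℝ} (hγ : 0 < γ) (p x : X) :
    x ∈ TiltArgmin f xb γ p ↔ ‖x - xb‖ ≤ γ ∧ f x ≠ ⊤ ∧
      ∀ y, ‖y - xb‖ ≤ γ → f y ≠ ⊤ →
        (f x).toReal - ⟪p, x⟫ ≤ (f y).toReal - ⟪p, y⟫ := by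
  unfold TiltArgmin
  simp only [Set.mem_setOf_eq, mem_closedBall, dist_eq_norm]
  constructor
  · rintro ⟨h1, h2⟩
    have hxt : f x ≠ ⊤ := by
      intro ht
      have := h2 xb (by simpa using hγ.le)
      rw [ht, ← EReal.coe_toReal hxb (hbot xb), ← EReal.coe_sub, EReal.top_sub_coe] at this
      exact absurd (top_le_iff.1 this) (EReal.coe_ne_top _)
    refine ⟨h1, hxt, fun y hy hyt => ?_⟩
    have := h2 y hy
    rw [← EReal.coe_toReal hxt (hbot x), ← EReal.coe_toReal hyt (hbot y), ← EReal.coe_sub,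
      ← EReal.coe_sub, EReal.coe_le_coe_iff] at this
    exact this
  · rintro ⟨h1, hxt, h2⟩
    refine ⟨h1, fun y hy => ?_⟩
    by_cases hyt : f y = ⊤
    · rw [hyt, EReal.top_sub_coe]; exact le_top
    · rw [← EReal.coe_toReal hxt (hbot x), ← EReal.coe_toReal hyt (hbot y), ← EReal.coe_sub,
        ← EReal.coe_sub, EReal.coe_le_coe_iff]
      exact h2 y hy hyt

/-- Local consequences of prox-regularity and subdifferential continuity, in real form. -/
def PRS (f : X → EReal) (xb : X) (r ε : ℝ) : Prop :=
  0 < r ∧ 0 < ε ∧ ∀ u p, ‖u - xb‖ ≤ ε → ‖p‖ ≤ ε → p ∈ LimitingSubdiff f u →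
    f u ≠ ⊤ ∧ ∀ x, ‖x - xb‖ ≤ ε → f x ≠ ⊤ →
      (f u).toReal + ⟪p, x - u⟫ - r / 2 * ‖x - u‖ ^ 2 ≤ (f x).toReal

theorem aux_PRS {f : X → EReal} (hbot : ∀ x, f x ≠ ⊥) {xb : X}
    (hpr : ProxRegularAt f xb 0) (hsc : SubdiffContAt f xb 0) :
    ∃ r ε, PRS f xb r ε := by
  obtain ⟨hxb, r, hr, ε, hε, h⟩ := hpr
  set a := (f xb).toReal with ha
  have hfa : f xb = (a : EReal) := (EReal.coe_toReal hxb (hbot xb)).symm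
  have hev : ∀ᶠ y : EReal in 𝓝 (f xb), ((a - ε : ℝ) : EReal) < y ∧ y < ((a + ε : ℝ) : EReal) := by
    rw [hfa]
    exact (lt_mem_nhds (EReal.coe_lt_coe_iff.2 (by linarith))).and
      (gt_mem_nhds (EReal.coe_lt_coe_iff.2 (by linarith)))
  have h2 := hsc.eventually hev
  rw [eventually_nhdsWithin_iff, Metric.eventually_nhds_iff] at h2
  obtain ⟨δ, hδ, h3⟩ := h2
  refine ⟨r, min ε (δ / 2), hr, by positivity, ?_⟩
  intro u p hu hp hpu
  have h4 : ((a - ε : ℝ) : EReal) < f u ∧ f u < ((a + ε : ℝ) : EReal) := by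
    refine @h3 (u, p) ?_ hpu
    rw [Prod.dist_eq, max_lt_iff]
    constructor
    · rw [dist_eq_norm]
      have := min_le_right ε (δ / 2)
      show ‖u - xb‖ < δ
      linarith
    · rw [dist_eq_norm]
      have := min_le_right ε (δ / 2)
      show ‖p - 0‖ < δ
      rw [sub_zero]
      linarith
  have hut : f u ≠ ⊤ := ne_top_of_lt h4.2
  refine ⟨hut, fun x hx hxt => ?_⟩
  have hm := min_le_left ε (δ / 2)
  have h5 := h x (by rw [mem_closedBall, dist_eq_norm]; linarith) u
    (by rw [mem_closedBall, dist_eq_norm]; linarith)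
  have hfu := EReal.coe_toReal hut (hbot u)
  rw [hfa, ← hfu, ← EReal.coe_toReal hxt (hbot x)] at h5
  rw [← hfu, EReal.coe_lt_coe_iff, EReal.coe_lt_coe_iff] at h4
  have h6 := h5 (by rw [← EReal.coe_add, EReal.coe_le_coe_iff]; linarith)
    (by rw [← EReal.coe_add, EReal.coe_le_coe_iff]; linarith) p hpu
    (by rw [mem_closedBall, dist_eq_norm, sub_zero]; linarith)
  rw [← EReal.coe_add, EReal.coe_le_coe_iff] at h6
  linarith

/-- Banach fixed point on a closed ball. -/
theorem aux_fixed [ProperSpace X] (Φ : X → X) (a : X) (R θ : ℝ) (hR : 0 ≤ R) (hθ : θ < 1)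
    (hmaps : ∀ z, ‖z - a‖ ≤ R → ‖Φ z - a‖ ≤ R)
    (hΦ : ∀ z z', ‖z - a‖ ≤ R → ‖z' - a‖ ≤ R → ‖Φ z - Φ z'‖ ≤ θ * ‖z - z'‖) :
    ∃ z, ‖z - a‖ ≤ R ∧ Φ z = z := by
  have hc : ContinuousOn Φ (closedBall a R) := by
    refine (LipschitzOnWith.of_dist_le_mul (K := Real.toNNReal |θ|) ?_).continuousOn
    intro x hx y hy
    rw [mem_closedBall, dist_eq_norm] at hx hy
    rw [dist_eq_norm, dist_eq_norm, Real.coe_toNNReal _ (abs_nonneg _)]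
    exact (hΦ x y hx hy).trans (mul_le_mul_of_nonneg_right (le_abs_self θ) (norm_nonneg _))
  obtain ⟨z, hz, hmin⟩ := (isCompact_closedBall a R).exists_isMinOn
    (f := fun z => ‖Φ z - z‖) ⟨a, by simpa using hR⟩ ((hc.sub continuousOn_id).norm)
  rw [mem_closedBall, dist_eq_norm] at hz
  refine ⟨z, hz, ?_⟩
  have h1 : ‖Φ z - z‖ ≤ ‖Φ (Φ z) - Φ z‖ := hmin (by
    rw [mem_closedBall, dist_eq_norm]; exact hmaps z hz)
  have h2 := hΦ (Φ z) z (hmaps z hz) hz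
  have h3 : ‖Φ z - z‖ = 0 := by
    have := norm_nonneg (Φ z - z)
    by_contra hne
    have : 0 < ‖Φ z - z‖ := lt_of_le_of_ne this (Ne.symm hne)
    nlinarith
  exact sub_eq_zero.1 (norm_eq_zero.1 h3)

theorem aux_two_lip {f : X → EReal} {xb : X} {r ε : ℝ} (H : PRS f xb r ε) {x p x' p' : X}
    (hx : ‖x - xb‖ ≤ ε) (hp : ‖p‖ ≤ ε) (hxp : p ∈ LimitingSubdiff f x)
    (hx' : ‖x' - xb‖ ≤ ε) (hp' : ‖p'‖ ≤ ε) (hxp' : p' ∈ LimitingSubdiff f x') :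
    ‖x - x'‖ ≤ 2 * ‖(x + (1 / (2 * r)) • p) - (x' + (1 / (2 * r)) • p')‖ := by
  obtain ⟨hr, hε, h⟩ := H
  obtain ⟨h1, h1'⟩ := h x p hx hp hxp
  obtain ⟨h2, h2'⟩ := h x' p' hx' hp' hxp'
  have h3 := h1' x' hx' h2
  have h4 := h2' x hx h1
  have e1 : ⟪p, x' - x⟫ = - ⟪p, x - x'⟫ := by rw [← inner_neg_right, neg_sub]
  rw [e1, norm_sub_rev] at h3
  have h5 : - r * ‖x - x'‖ ^ 2 ≤ ⟪p - p', x - x'⟫ := by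
    rw [inner_sub_left]; linarith
  have e2 : (x + (1 / (2 * r)) • p) - (x' + (1 / (2 * r)) • p')
      = (x - x') + (1 / (2 * r)) • (p - p') := by
    rw [smul_sub]; abel
  rw [e2]
  set D := (x - x') + (1 / (2 * r)) • (p - p') with hD
  have h6 : ⟪D, x - x'⟫ = ‖x - x'‖ ^ 2 + (1 / (2 * r)) * ⟪p - p', x - x'⟫ := by
    rw [hD, inner_add_left, real_inner_smul_left, real_inner_self_eq_norm_sq]
  have h7 := real_inner_le_norm D (x - x')
  have h8 : ‖x - x'‖ ^ 2 / 2 ≤ ⟪D, x - x'⟫ := by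
    rw [h6]
    have : (1 / (2 * r)) * (- r * ‖x - x'‖ ^ 2) ≤ (1 / (2 * r)) * ⟪p - p', x - x'⟫ :=
      mul_le_mul_of_nonneg_left h5 (by positivity)
    have e3 : (1 / (2 * r)) * (- r * ‖x - x'‖ ^ 2) = - (‖x - x'‖ ^ 2 / 2) := by
      field_simp
    linarith
  by_cases hn : ‖x - x'‖ = 0
  · rw [hn]; positivity
  · have : 0 < ‖x - x'‖ := lt_of_le_of_ne (norm_nonneg _) (Ne.symm hn)
    nlinarith

/-- Local proximal mapping data. -/
structure ProxData (f : X → EReal) (xb : X) (r ε ρ : ℝ) (P : X → X) : Prop where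
  rho_pos : 0 < ρ
  rho_le : ρ ≤ ε
  fix : P xb = xb
  close : ∀ z, ‖z - xb‖ ≤ ρ → ‖P z - xb‖ < ε
  close' : ∀ z, ‖z - xb‖ ≤ ρ → ‖(2 * r) • (z - P z)‖ < ε
  mem : ∀ z, ‖z - xb‖ ≤ ρ → (2 * r) • (z - P z) ∈ LimitingSubdiff f (P z)
  fin : ∀ z, ‖z - xb‖ ≤ ρ → f (P z) ≠ ⊤
  min : ∀ z, ‖z - xb‖ ≤ ρ → ∀ y, ‖y - xb‖ ≤ ε → f y ≠ ⊤ →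
    (f (P z)).toReal + r * ‖P z - z‖ ^ 2 ≤ (f y).toReal + r * ‖y - z‖ ^ 2
  lip : ∀ z z', ‖z - xb‖ ≤ ρ → ‖z' - xb‖ ≤ ρ → ‖P z - P z'‖ ≤ 2 * ‖z - z'‖
  uniq : ∀ x p, ‖x - xb‖ ≤ ε → ‖p‖ ≤ ε → p ∈ LimitingSubdiff f x →
    ‖x + (1 / (2 * r)) • p - xb‖ ≤ ρ → P (x + (1 / (2 * r)) • p) = x

theorem aux_prox [ProperSpace X] {f : X → EReal} (hbot : ∀ x, f x ≠ ⊥)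
    (hlsc : LowerSemicontinuous f) {xb : X} (h0 : (0 : X) ∈ LimitingSubdiff f xb)
    {r ε : ℝ} (H : PRS f xb r ε) : ∃ ρ P, ProxData f xb r ε ρ P := by
  have H' := H
  obtain ⟨hr, hε, h⟩ := H'
  obtain ⟨hxbt, hmin0⟩ := h xb 0 (by simpa using hε.le) (by simpa using hε.le) h0
  set ρ := min (ε / 8) (ε / (20 * r)) with hρdef
  have hρ : 0 < ρ := by positivity
  have hρ1 : ρ ≤ ε / 8 := min_le_left _ _
  have hρ2 : 20 * r * ρ ≤ ε := by
    have : ρ ≤ ε / (20 * r) := min_le_right _ _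
    rw [le_div_iff₀ (by positivity)] at this
    linarith
  have key : ∀ z, ‖z - xb‖ ≤ ρ → ∃ x, ‖x - xb‖ < ε ∧ ‖(2 * r) • (z - x)‖ < ε ∧
      (2 * r) • (z - x) ∈ LimitingSubdiff f x ∧ f x ≠ ⊤ ∧
      ∀ y, ‖y - xb‖ ≤ ε → f y ≠ ⊤ →
        (f x).toReal + r * ‖x - z‖ ^ 2 ≤ (f y).toReal + r * ‖y - z‖ ^ 2 := by
    intro z hz
    obtain ⟨x, hxS, hxt, hx⟩ := aux_exists_min hbot hlsc (isCompact_closedBall xb ε)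
      (mem_closedBall_self hε.le) hxbt (fun y => r * ‖y - z‖ ^ 2) (by fun_prop)
    simp only [mem_closedBall, dist_eq_norm] at hxS hx
    have h1 := hx xb (by simpa using hε.le) hxbt
    have h2 := hmin0 x hxS hxt
    rw [inner_zero_left] at h2
    rw [norm_sub_rev xb z] at h1
    have h3 : ‖x - xb‖ ≤ ‖x - z‖ + ‖z - xb‖ := norm_sub_le_norm_sub_add_norm_sub _ _ _
    have h3' : ‖x - z‖ ≤ ‖x - xb‖ + ‖z - xb‖ := by
      have := norm_sub_le_norm_sub_add_norm_sub x xb z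
      rwa [norm_sub_rev xb z] at this
    set d := ‖x - xb‖ with hd
    set δ := ‖z - xb‖ with hδ
    set e := ‖x - z‖ with he
    have hd0 : 0 ≤ d := norm_nonneg _
    have hδ0 : 0 ≤ δ := norm_nonneg _
    have he0 : 0 ≤ e := norm_nonneg _
    have h4 : e ^ 2 ≤ δ ^ 2 + d ^ 2 / 2 := by
      have : r * e ^ 2 ≤ r * (δ ^ 2 + d ^ 2 / 2) := by linarith
      exact le_of_mul_le_mul_left this hr
    have h5 : d ≤ 4 * δ := by
      by_contra hcon
      push Not at hcon
      have : (d - δ) ^ 2 ≤ e ^ 2 := by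
        apply pow_le_pow_left₀ <;> linarith
      nlinarith
    have hdlt : d < ε := by linarith
    refine ⟨x, hdlt, ?_, ?_, hxt, hx⟩
    · rw [norm_smul, Real.norm_of_nonneg (by positivity), norm_sub_rev]
      have : e ≤ 5 * ρ := by linarith
      have : 2 * r * e ≤ 2 * r * (5 * ρ) := mul_le_mul_of_nonneg_left this (by positivity)
      show 2 * r * e < ε
      have : 0 < r * ρ := by positivity
      linarith
    · refine aux_mem_subdiff hbot (δ := ε - d) (C := r) (by linarith) hxt ?_
      intro y hy hyt
      have h6 := hx y (by
        have := norm_sub_le_norm_sub_add_norm_sub y x xb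
        linarith) hyt
      have e1 : y - z = (y - x) - (z - x) := by abel
      have e2 : e = ‖z - x‖ := by rw [he, norm_sub_rev]
      rw [e1, e2, norm_sub_sq_real (y - x) (z - x)] at h6
      rw [real_inner_smul_left, real_inner_comm]
      linarith
  have key' : ∀ z, ∃ x, ‖z - xb‖ ≤ ρ → ‖x - xb‖ < ε ∧ ‖(2 * r) • (z - x)‖ < ε ∧
      (2 * r) • (z - x) ∈ LimitingSubdiff f x ∧ f x ≠ ⊤ ∧
      ∀ y, ‖y - xb‖ ≤ ε → f y ≠ ⊤ →
        (f x).toReal + r * ‖x - z‖ ^ 2 ≤ (f y).toReal + r * ‖y - z‖ ^ 2 := by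
    intro z
    by_cases hz : ‖z - xb‖ ≤ ρ
    · obtain ⟨x, hx⟩ := key z hz
      exact ⟨x, fun _ => hx⟩
    · exact ⟨0, fun hz' => absurd hz' hz⟩
  choose P hP using key'
  have erec : ∀ z, P z + (1 / (2 * r)) • ((2 * r) • (z - P z)) = z := by
    intro z
    rw [smul_smul, one_div_mul_cancel (by positivity), one_smul]; abel
  have huniq : ∀ x p, ‖x - xb‖ ≤ ε → ‖p‖ ≤ ε → p ∈ LimitingSubdiff f x →
    ‖x + (1 / (2 * r)) • p - xb‖ ≤ ρ → P (x + (1 / (2 * r)) • p) = x := by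
    intro x p hx hp hxp hz
    obtain ⟨a1, a2, a3, -, -⟩ := hP _ hz
    have := aux_two_lip H a1.le a2.le a3 hx hp hxp
    rw [erec, sub_self, norm_zero, mul_zero] at this
    exact sub_eq_zero.1 (norm_le_zero_iff.1 this)
  refine ⟨ρ, P, hρ, by linarith, ?_, fun z hz => (hP z hz).1, fun z hz => (hP z hz).2.1,
    fun z hz => (hP z hz).2.2.1, fun z hz => (hP z hz).2.2.2.1, fun z hz => (hP z hz).2.2.2.2,
    ?_, huniq⟩
  · have := huniq xb 0 (by simpa using hε.le) (by simpa using hε.le) h0 (by simpa using hρ.le)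
    simpa using this
  · intro z z' hz hz'
    obtain ⟨a1, a2, a3, -, -⟩ := hP _ hz
    obtain ⟨b1, b2, b3, -, -⟩ := hP _ hz'
    have := aux_two_lip H a1.le a2.le a3 b1.le b2.le b3
    rwa [erec, erec] at this

/-- A contraction property of the proximal mapping yields tilt stability. -/
theorem aux_tilt_of_contraction [ProperSpace X] {f : X → EReal} (hbot : ∀ x, f x ≠ ⊥)
    (hlsc : LowerSemicontinuous f) {xb : X} (hxb : f xb ≠ ⊤)
    {r ε ρ : ℝ} (hr : 0 < r) {P : X → X} (D : ProxData f xb r ε ρ P) {θ σ : ℝ}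
    (hθ0 : 0 ≤ θ) (hθ : θ < 1) (hσ : 0 < σ) (hσρ : σ ≤ ρ)
    (hc : ∀ z z', ‖z - xb‖ ≤ σ → ‖z' - xb‖ ≤ σ → ‖P z - P z'‖ ≤ θ * ‖z - z'‖) :
    TiltStable f xb := by
  set γ := σ / 4 with hγdef
  have hγ : 0 < γ := by positivity
  set c := 1 / (2 * r) with hcdef
  have hcpos : 0 < c := by positivity
  set τ := (1 - θ) * γ / c with hτdef
  have hτ : 0 < τ := by
    have : 0 < 1 - θ := by linarith
    positivity
  have hτc : c * τ = (1 - θ) * γ := by rw [hτdef]; field_simp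
  have hmem : ∀ z p, ∀ k : ℝ, ‖z - xb‖ ≤ k → ‖p‖ ≤ τ →
      ‖z + c • p - xb‖ ≤ k + (1 - θ) * γ := by
    intro z p k hz hp
    have e : z + c • p - xb = (z - xb) + c • p := by abel
    rw [e]
    refine (norm_add_le _ _).trans ?_
    rw [norm_smul, Real.norm_of_nonneg hcpos.le, ← hτc]
    have := mul_le_mul_of_nonneg_left hp hcpos.le
    linarith
  have hmem' : ∀ z p, ‖z - xb‖ ≤ 3 * γ → ‖p‖ ≤ τ → ‖z + c • p - xb‖ ≤ σ := by
    intro z p hz hp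
    have := hmem z p _ hz hp
    nlinarith
  have hcontr : ∀ p q z z', ‖p‖ ≤ τ → ‖q‖ ≤ τ → ‖z - xb‖ ≤ 3 * γ → ‖z' - xb‖ ≤ 3 * γ →
      ‖P (z + c • p) - P (z' + c • q)‖ ≤ θ * (‖z - z'‖ + c * ‖p - q‖) := by
    intro p q z z' hp hq hz hz'
    refine (hc _ _ (hmem' z p hz hp) (hmem' z' q hz' hq)).trans ?_
    refine mul_le_mul_of_nonneg_left ?_ hθ0
    have e : z + c • p - (z' + c • q) = (z - z') + c • (p - q) := by
      rw [smul_sub]; abel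
    rw [e]
    refine (norm_add_le _ _).trans ?_
    rw [norm_smul, Real.norm_of_nonneg hcpos.le]
  have hfix : ∀ p, ‖p‖ ≤ τ → ∃ s, ‖s - xb‖ ≤ γ ∧ P (s + c • p) = s := by
    intro p hp
    refine aux_fixed (fun z => P (z + c • p)) xb γ θ hγ.le hθ ?_ ?_
    · intro z hz
      have h1 := hc (z + c • p) xb (hmem' z p (by linarith) hp) (by simpa using hσ.le)
      rw [D.fix] at h1
      have h2 := hmem z p _ hz hp
      have h3 : θ * ‖z + c • p - xb‖ ≤ θ * (γ + (1 - θ) * γ) := mul_le_mul_of_nonneg_left h2 hθ0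
      have h4 : θ * (γ + (1 - θ) * γ) ≤ γ := by
        nlinarith [sq_nonneg (1 - θ), mul_nonneg hγ.le (sq_nonneg (1 - θ))]
      exact h1.trans (h3.trans h4)
    · intro z z' hz hz'
      have := hcontr p p z z' hp hp (by linarith) (by linarith)
      simpa using this
  have hfix' : ∀ p, ∃ s, ‖p‖ ≤ τ → ‖s - xb‖ ≤ γ ∧ P (s + c • p) = s := by
    intro p
    by_cases hp : ‖p‖ ≤ τ
    · obtain ⟨s, hs⟩ := hfix p hp
      exact ⟨s, fun _ => hs⟩
    · exact ⟨0, fun h => absurd h hp⟩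
  choose m hm using hfix'
  have huniq : ∀ p z, ‖p‖ ≤ τ → ‖z - xb‖ ≤ 3 * γ → P (z + c • p) = z → z = m p := by
    intro p z hp hz hPz
    obtain ⟨h1, h2⟩ := hm p hp
    have := hcontr p p z (m p) hp hp hz (by linarith)
    rw [hPz, h2, sub_self, norm_zero, mul_zero, add_zero] at this
    have h3 : ‖z - m p‖ ≤ 0 := by nlinarith [norm_nonneg (z - m p)]
    exact sub_eq_zero.1 (norm_le_zero_iff.1 h3)
  have hdec : ∀ p z, ‖p‖ ≤ τ → ‖z - xb‖ ≤ 3 * γ → f z ≠ ⊤ →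
      (f (P (z + c • p))).toReal - ⟪p, P (z + c • p)⟫ + r * ‖P (z + c • p) - z‖ ^ 2
        ≤ (f z).toReal - ⟪p, z⟫ := by
    intro p z hp hz hzt
    have h1 := D.min (z + c • p) ((hmem' z p hz hp).trans hσρ) z
      (by have := D.rho_le; linarith) hzt
    have e1 : z - (z + c • p) = - (c • p) := by abel
    have e2 : P (z + c • p) - (z + c • p) = (P (z + c • p) - z) - c • p := by abel
    rw [e1, e2, norm_neg, norm_sub_sq_real, real_inner_smul_right, inner_sub_left,
      real_inner_comm, real_inner_comm p z] at h1
    have e3 : r * (2 * (c * (⟪p, P (z + c • p)⟫ - ⟪p, z⟫)))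
        = ⟪p, P (z + c • p)⟫ - ⟪p, z⟫ := by
      rw [hcdef]; field_simp
    linarith
  -- the minimizer over the ball of radius `2γ` around `m p`
  have hglob : ∀ p, ‖p‖ ≤ τ → f (m p) ≠ ⊤ ∧ ∀ y, ‖y - xb‖ ≤ γ → f y ≠ ⊤ →
      (f (m p)).toReal - ⟪p, m p⟫ ≤ (f y).toReal - ⟪p, y⟫ := by
    intro p hp
    obtain ⟨h1, h2⟩ := hm p hp
    have hball : ∀ y, ‖y - m p‖ ≤ 2 * γ → ‖y - xb‖ ≤ 3 * γ := by
      intro y hy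
      have := norm_sub_le_norm_sub_add_norm_sub y (m p) xb
      linarith
    have hmpt : f (m p) ≠ ⊤ := by
      rw [← h2]; exact D.fin _ ((hmem' _ p (by linarith) hp).trans hσρ)
    obtain ⟨x, hxS, hxt, hx⟩ := aux_exists_min hbot hlsc (isCompact_closedBall (m p) (2 * γ))
      (mem_closedBall_self (by positivity)) hmpt (fun y => - ⟪p, y⟫) (by fun_prop)
    simp only [mem_closedBall, dist_eq_norm] at hxS hx
    have h3 := hdec p x hp (hball x hxS) hxt
    have h4 : ‖P (x + c • p) - m p‖ ≤ 2 * γ := by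
      have := hcontr p p x (m p) hp hp (hball x hxS) (by linarith)
      rw [h2, sub_self, norm_zero, mul_zero, add_zero] at this
      nlinarith [norm_nonneg (x - m p)]
    have h5 := hx _ h4 (D.fin _ ((hmem' _ p (hball x hxS) hp).trans hσρ))
    have h6 : r * ‖P (x + c • p) - x‖ ^ 2 ≤ 0 := by linarith
    have h7 : ‖P (x + c • p) - x‖ = 0 := by
      have h8 : ‖P (x + c • p) - x‖ ^ 2 ≤ 0 := by
        by_contra hcon
        push Not at hcon
        have := mul_pos hr hcon
        linarith
      exact pow_eq_zero_iff (two_ne_zero) |>.1 (le_antisymm h8 (sq_nonneg _))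
    have h9 : x = m p := huniq p x hp (hball x hxS) (sub_eq_zero.1 (norm_eq_zero.1 h7))
    subst h9
    refine ⟨hmpt, fun y hy hyt => ?_⟩
    have := hx y (by
      have := norm_sub_le_norm_sub_add_norm_sub y xb (m p)
      rw [norm_sub_rev xb] at this
      linarith) hyt
    linarith
  refine ⟨γ, hγ, closedBall 0 τ, closedBall_mem_nhds _ hτ, m, Real.toNNReal (θ * c / (1 - θ)),
    ?_, ?_, ?_⟩
  · intro p hp
    rw [mem_closedBall, dist_zero_right] at hp
    ext x
    rw [aux_mem_tilt hbot hxb hγ, Set.mem_singleton_iff]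
    constructor
    · rintro ⟨h1, h2, h3⟩
      obtain ⟨g1, g2⟩ := hm p hp
      refine huniq p x hp (by linarith) ?_
      have h4 := hdec p x hp (by linarith) h2
      have h5 : ‖P (x + c • p) - xb‖ ≤ γ := by
        have k1 := hc (x + c • p) xb (hmem' x p (by linarith) hp) (by simpa using hσ.le)
        rw [D.fix] at k1
        have k2 := hmem x p _ h1 hp
        have k3 : θ * ‖x + c • p - xb‖ ≤ θ * (γ + (1 - θ) * γ) :=
          mul_le_mul_of_nonneg_left k2 hθ0
        have k4 : θ * (γ + (1 - θ) * γ) ≤ γ := by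
          nlinarith [mul_nonneg hγ.le (sq_nonneg (1 - θ))]
        exact k1.trans (k3.trans k4)
      have h6 := h3 _ h5 (D.fin _ ((hmem' _ p (by linarith) hp).trans hσρ))
      have h8 : ‖P (x + c • p) - x‖ ^ 2 ≤ 0 := by
        by_contra hcon
        push Not at hcon
        have := mul_pos hr hcon
        linarith
      have h9 : ‖P (x + c • p) - x‖ = 0 :=
        pow_eq_zero_iff (two_ne_zero) |>.1 (le_antisymm h8 (sq_nonneg _))
      exact sub_eq_zero.1 (norm_eq_zero.1 h9)
    · rintro rfl
      exact ⟨(hm p hp).1, (hglob p hp).1, (hglob p hp).2⟩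
  · refine LipschitzOnWith.of_dist_le_mul ?_
    intro p hp q hq
    rw [mem_closedBall, dist_zero_right] at hp hq
    have h1θ : 0 < 1 - θ := by linarith
    rw [dist_eq_norm, dist_eq_norm, Real.coe_toNNReal _ (by positivity)]
    have := hcontr p q (m p) (m q) hp hq (by linarith [(hm p hp).1]) (by linarith [(hm q hq).1])
    rw [(hm p hp).2, (hm q hq).2] at this
    rw [div_mul_eq_mul_div, le_div_iff₀ h1θ]
    linarith
  · refine (huniq 0 xb (by simpa using hτ.le) (by simpa using hγ.le) ?_).symm
    rw [smul_zero, add_zero, D.fix]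

theorem aux_normal_smul {Ω : Set (X × X)} {z : X × X} {w v : X} {t : ℝ} (ht : 0 < t)
    (h : (w, v) ∈ FrechetNormalP Ω z) : (t • w, t • v) ∈ FrechetNormalP Ω z := by
  intro ε hε
  obtain ⟨δ, hδ, h1⟩ := h (ε / t) (by positivity)
  refine ⟨δ, hδ, fun y hy hyz => ?_⟩
  have h2 := h1 y hy hyz
  simp only [real_inner_smul_left] at h2 ⊢
  rw [div_mul_eq_mul_div, le_div_iff₀ ht] at h2
  linarith

/-- Uniform estimate for Fréchet normals near the reference point. -/
theorem aux_normal_est [ProperSpace X] {f : X → EReal} {xb : X}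
    {r ε ρ : ℝ} (hr : 0 < r) {P : X → X} (D : ProxData f xb r ε ρ P)
    (hker : {u : X | (0 : X) ∈ SecondSubdiff f xb 0 u} = {0})
    (hpsd : ∀ u w : X, w ∈ SecondSubdiff f xb 0 u → u ≠ 0 → 0 ≤ ⟪w, u⟫) :
    ∃ η > 0, ∃ ρ₁ > 0, ρ₁ ≤ ρ ∧ ∀ z, ‖z - xb‖ ≤ ρ₁ → ∀ h u : X, ‖u‖ = 1 →
      ((2 * r) • (h - u), -u) ∈
        FrechetNormalP {q : X × X | q.2 ∈ LimitingSubdiff f q.1} (P z, (2 * r) • (z - P z)) →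
      1 + η < ‖h‖ := by
  by_contra hcon
  push Not at hcon
  have hk : ∀ k : ℕ, ∃ z h u : X, ‖z - xb‖ ≤ min ρ (1 / ((k : ℝ) + 1)) ∧ ‖u‖ = 1 ∧
      ((2 * r) • (h - u), -u) ∈
        FrechetNormalP {q : X × X | q.2 ∈ LimitingSubdiff f q.1} (P z, (2 * r) • (z - P z)) ∧
      ‖h‖ ≤ 1 + 1 / ((k : ℝ) + 1) := by
    intro k
    have hkp : (0 : ℝ) < 1 / ((k : ℝ) + 1) := by positivity
    obtain ⟨z, hz, h, u, hu, hn, hh⟩ := hcon (1 / ((k : ℝ) + 1)) hkp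
      (min ρ (1 / ((k : ℝ) + 1))) (lt_min D.rho_pos hkp) (min_le_left _ _)
    exact ⟨z, h, u, hz, hu, hn, hh⟩
  choose z h u hz hu hn hh using hk
  have hlim : Tendsto (fun k : ℕ => 1 / ((k : ℝ) + 1)) atTop (𝓝 0) :=
    tendsto_one_div_add_atTop_nhds_zero_nat
  have hzlim : Tendsto z atTop (𝓝 xb) := by
    rw [tendsto_iff_norm_sub_tendsto_zero]
    exact squeeze_zero (fun k => norm_nonneg _) (fun k => (hz k).trans (min_le_right _ _)) hlim
  have hPlim : Tendsto (fun k => P (z k)) atTop (𝓝 xb) := by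
    rw [tendsto_iff_norm_sub_tendsto_zero]
    refine squeeze_zero (fun k => norm_nonneg _) (g := fun k => 2 * ‖z k - xb‖) (fun k => ?_) ?_
    · have := D.lip (z k) xb ((hz k).trans (min_le_left _ _)) (by simpa using D.rho_pos.le)
      rwa [D.fix] at this
    · have := (tendsto_iff_norm_sub_tendsto_zero.1 hzlim).const_mul 2
      simpa using this
  have hbd : ∀ k, (h k, u k) ∈ (closedBall (0 : X) 2) ×ˢ (closedBall (0 : X) 1) := by
    intro k
    refine ⟨?_, ?_⟩
    · rw [mem_closedBall, dist_zero_right]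
      refine (hh k).trans ?_
      have : 1 / ((k : ℝ) + 1) ≤ 1 := by
        rw [div_le_one (by positivity)]; linarith [Nat.cast_nonneg (α := ℝ) k]
      linarith
    · rw [mem_closedBall, dist_zero_right]
      exact (hu k).le
  obtain ⟨⟨h', u'⟩, -, φ, hφ, hconv⟩ :=
    ((isCompact_closedBall (0 : X) 2).prod (isCompact_closedBall (0 : X) 1)).tendsto_subseq hbd
  have hh' : Tendsto (fun k => h (φ k)) atTop (𝓝 h') := (continuous_fst.tendsto _).comp hconv
  have hu' : Tendsto (fun k => u (φ k)) atTop (𝓝 u') := (continuous_snd.tendsto _).comp hconv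
  have hu1 : ‖u'‖ = 1 := by
    refine tendsto_nhds_unique hu'.norm ?_
    simp only [hu]
    exact tendsto_const_nhds
  have hh1 : ‖h'‖ ≤ 1 := by
    have h1 : Tendsto (fun k => 1 + 1 / (((φ k : ℕ) : ℝ) + 1)) atTop (𝓝 (1 + 0)) :=
      (hlim.comp hφ.tendsto_atTop).const_add 1
    rw [add_zero] at h1
    exact le_of_tendsto_of_tendsto' hh'.norm h1 (fun k => hh (φ k))
  have hmem : (2 * r) • (h' - u') ∈ SecondSubdiff f xb 0 u' := by
    refine ⟨fun k => (P (z (φ k)), (2 * r) • (z (φ k) - P (z (φ k)))),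
      fun k => ((2 * r) • (h (φ k) - u (φ k)), - u (φ k)),
      fun k => ⟨D.mem _ ((hz _).trans (min_le_left _ _)), hn _⟩, ?_, ?_⟩
    · refine (hPlim.comp hφ.tendsto_atTop).prodMk_nhds ?_
      have := ((hzlim.sub hPlim).const_smul (2 * r)).comp hφ.tendsto_atTop
      rw [sub_self, smul_zero] at this
      exact this
    · exact ((hh'.sub hu').const_smul (2 * r)).prodMk_nhds hu'.neg
  have hune : u' ≠ 0 := by
    intro h0; rw [h0, norm_zero] at hu1; exact zero_ne_one hu1
  have h1 := hpsd _ _ hmem hune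
  rw [real_inner_smul_left, inner_sub_left, real_inner_self_eq_norm_sq, hu1] at h1
  have h2 : 1 ≤ ⟪h', u'⟫ := by
    have : 0 ≤ ⟪h', u'⟫ - 1 ^ 2 := by
      by_contra hc
      push Not at hc
      have := mul_neg_of_pos_of_neg (by positivity : (0 : ℝ) < 2 * r) hc
      linarith
    linarith
  have h3 : ‖h' - u'‖ ^ 2 ≤ 0 := by
    rw [norm_sub_sq_real, hu1]
    have : ‖h'‖ ^ 2 ≤ 1 := by nlinarith [norm_nonneg h']
    linarith
  have h4 : h' - u' = 0 := norm_eq_zero.1 (pow_eq_zero_iff (two_ne_zero) |>.1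
    (le_antisymm h3 (sq_nonneg _)))
  rw [h4, smul_zero] at hmem
  have h5 : u' ∈ {u : X | (0 : X) ∈ SecondSubdiff f xb 0 u} := hmem
  rw [hker] at h5
  exact hune h5

theorem aux_contraction [ProperSpace X] {f : X → EReal} {xb : X}
    {r ε ρ : ℝ} (hr : 0 < r) {P : X → X} (D : ProxData f xb r ε ρ P)
    (hker : {u : X | (0 : X) ∈ SecondSubdiff f xb 0 u} = {0})
    (hpsd : ∀ u w : X, w ∈ SecondSubdiff f xb 0 u → u ≠ 0 → 0 ≤ ⟪w, u⟫) :
    ∃ θ σ : ℝ, 0 ≤ θ ∧ θ < 1 ∧ 0 < σ ∧ σ ≤ ρ ∧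
      ∀ z z', ‖z - xb‖ ≤ σ → ‖z' - xb‖ ≤ σ → ‖P z - P z'‖ ≤ θ * ‖z - z'‖ := by
  obtain ⟨η, hη, ρ₁, hρ₁, hρ₁ρ, hest⟩ := aux_normal_est hr D hker hpsd
  set α := 1 / (1 + η) with hα
  have hα0 : 0 < α := by positivity
  have hα1 : α < 1 := by rw [hα, div_lt_one (by positivity)]; linarith
  have hαη : α * (1 + η) = 1 := by rw [hα]; field_simp
  set R := ρ₁ / 3 with hR
  have hRpos : 0 < R := by positivity
  set K := 2 / R with hK
  have hKpos : 0 < K := by positivity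
  have hKR : K * R = 2 := by rw [hK]; field_simp
  have cpos : 0 < 1 / (2 * r) := by positivity
  -- main estimate
  have main : ∀ b, ‖b - xb‖ ≤ R → ∀ h : X, ‖h‖ = 1 → ∀ z, ‖z - b‖ ≤ R →
      ⟪h, P z - P b⟫ ≤ α * ‖z - b‖ + K * ‖z - b‖ ^ 2 := by
    intro b hb h hh
    have hball : ∀ z, ‖z - b‖ ≤ R → ‖z - xb‖ ≤ 2 * R := by
      intro z hz
      have := norm_sub_le_norm_sub_add_norm_sub z b xb
      linarith
    have hPc : ContinuousOn P (closedBall b R) := by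
      refine (LipschitzOnWith.of_dist_le_mul (K := 2) ?_).continuousOn
      intro x hx y hy
      rw [mem_closedBall, dist_eq_norm] at hx hy
      rw [dist_eq_norm, dist_eq_norm]
      exact D.lip x y (by linarith [hball x hx]) (by linarith [hball y hy])
    obtain ⟨z, hz, hmin⟩ := (isCompact_closedBall b R).exists_isMinOn
      (f := fun z => - ⟪h, P z⟫ + (α * ‖z - b‖ + K * ‖z - b‖ ^ 2))
      ⟨b, by simpa using hRpos.le⟩ (by
        refine ContinuousOn.add ?_ (Continuous.continuousOn (by fun_prop))
        exact (continuousOn_const.inner hPc).neg)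
    rw [mem_closedBall, dist_eq_norm] at hz
    have hmin' : ∀ y, ‖y - b‖ ≤ R → - ⟪h, P z⟫ + (α * ‖z - b‖ + K * ‖z - b‖ ^ 2)
        ≤ - ⟪h, P y⟫ + (α * ‖y - b‖ + K * ‖y - b‖ ^ 2) := by
      intro y hy
      exact hmin (by rw [mem_closedBall, dist_eq_norm]; exact hy)
    have hzb : z = b := by
      by_contra hne
      have ha0 : 0 < ‖z - b‖ := norm_pos_iff.2 (sub_ne_zero.2 hne)
      set a := ‖z - b‖ with ha
      -- interior
      have hlt_aR : a < R := by
        rcases lt_or_eq_of_le hz with hlt | heq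
        · exact hlt
        exfalso
        have h1 := hmin' b (by simpa using hRpos.le)
        rw [sub_self, norm_zero, heq] at h1
        have h2 : ⟪h, P z - P b⟫ ≤ 2 * R := by
          refine (real_inner_le_norm _ _).trans ?_
          rw [hh, one_mul]
          have := D.lip z b (by linarith [hball z hz]) (by linarith)
          rw [← ha, heq] at this
          exact this
        rw [inner_sub_right] at h2
        have h3 : K * R ^ 2 = 2 * R := by rw [pow_two, ← mul_assoc, hKR]
        have h4 : 0 < α * R := by positivity
        rw [h3] at h1
        simp only [mul_zero, ne_eq, OfNat.ofNat_ne_zero, not_false_eq_true, zero_pow,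
          add_zero] at h1
        linarith
      set e := (1 / a) • (z - b) with he
      have hen : ‖e‖ = 1 := by
        rw [he, norm_smul, Real.norm_of_nonneg (by positivity), ← ha]
        field_simp
      have hzbe : z - b = a • e := by
        rw [he, smul_smul, mul_one_div_cancel ha0.ne', one_smul]
      set s := α + 2 * K * a with hs
      have hspos : 0 < s := by positivity
      set C := α / (2 * a) + K with hC
      have hCpos : 0 < C := by positivity
      -- local inequality in z
      have hloc : ∀ y, ‖y - b‖ ≤ R → ⟪h, P y - P z⟫ ≤ s * ⟪e, y - z⟫ + C * ‖y - z‖ ^ 2 := by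
        intro y hy
        have h1 := hmin' y hy
        have h2 : ‖y - b‖ ^ 2 = ‖y - z‖ ^ 2 + 2 * (a * ⟪e, y - z⟫) + a ^ 2 := by
          have e1 : y - b = (y - z) + (z - b) := by abel
          rw [e1, norm_add_sq_real, ← ha, hzbe, real_inner_smul_right, real_inner_comm]
        have h3 : ‖y - b‖ ≤ a + ⟪e, y - z⟫ + ‖y - z‖ ^ 2 / (2 * a) := by
          have h4 : ‖y - b‖ * (2 * a) ≤ ‖y - b‖ ^ 2 + a ^ 2 := by
            nlinarith [sq_nonneg (‖y - b‖ - a)]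
          have h5 : ‖y - b‖ ≤ (‖y - b‖ ^ 2 + a ^ 2) / (2 * a) := by
            rw [le_div_iff₀ (by positivity)]; exact h4
          refine h5.trans (le_of_eq ?_)
          rw [h2]; field_simp; ring
        have h6 := mul_le_mul_of_nonneg_left h3 hα0.le
        rw [inner_sub_right]
        have e2 : α * (a + ⟪e, y - z⟫ + ‖y - z‖ ^ 2 / (2 * a))
            = α * a + α * ⟪e, y - z⟫ + α / (2 * a) * ‖y - z‖ ^ 2 := by ring
        rw [h2] at h1
        rw [e2] at h6
        rw [hs, hC]
        linarith
      -- Fréchet normal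
      have hzρ : ‖z - xb‖ ≤ ρ₁ := by linarith [hball z hz]
      have hzρ' : ‖z - xb‖ < ρ₁ := by linarith [hball z hz]
      have hn : (h - s • e, - ((s / (2 * r)) • e)) ∈
          FrechetNormalP {q : X × X | q.2 ∈ LimitingSubdiff f q.1}
            (P z, (2 * r) • (z - P z)) := by
        intro ε' hε'
        set c := 1 / (2 * r) with hc
        set δ := min (min (ε - ‖P z - xb‖) (ε - ‖(2 * r) • (z - P z)‖))
          (min ((R - a) / (1 + c)) (ε' / (C * (1 + c) ^ 2))) with hδ
        have hd1 := D.close z (hzρ.trans hρ₁ρ)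
        have hd2 := D.close' z (hzρ.trans hρ₁ρ)
        refine ⟨δ, ?_, ?_⟩
        · refine lt_min (lt_min (by linarith) (by linarith)) (lt_min ?_ (by positivity))
          have : 0 < R - a := by linarith
          positivity
        rintro ⟨x', p'⟩ hT hdist
        have hdd : ∀ t, δ ≤ t → dist (x', p') (P z, (2 * r) • (z - P z)) < t :=
          fun t ht => lt_of_lt_of_le hdist ht
        set d := dist (x', p') (P z, (2 * r) • (z - P z)) with hd
        have hd0 : 0 ≤ d := dist_nonneg
        have hdx : ‖x' - P z‖ ≤ d := by
          rw [hd, Prod.dist_eq, ← dist_eq_norm]; exact le_max_left _ _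
        have hdp : ‖p' - (2 * r) • (z - P z)‖ ≤ d := by
          rw [hd, Prod.dist_eq, ← dist_eq_norm]; exact le_max_right _ _
        have k1 := hdd _ ((min_le_left _ _).trans (min_le_left _ _))
        have k2 := hdd _ ((min_le_left _ _).trans (min_le_right _ _))
        have k3 := hdd _ ((min_le_right _ _).trans (min_le_left _ _))
        have k4 := hdd _ ((min_le_right _ _).trans (min_le_right _ _))
        rw [lt_div_iff₀ (by positivity)] at k3 k4
        set y := x' + c • p' with hy
        have hyz : y - z = (x' - P z) + c • (p' - (2 * r) • (z - P z)) := by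
          rw [hy, smul_sub, smul_smul, hc, one_div_mul_cancel (by positivity), one_smul]; abel
        have hyzn : ‖y - z‖ ≤ (1 + c) * d := by
          rw [hyz]
          refine (norm_add_le _ _).trans ?_
          rw [norm_smul, Real.norm_of_nonneg cpos.le]
          have := mul_le_mul_of_nonneg_left hdp cpos.le
          linarith
        have hyb : ‖y - b‖ ≤ R := by
          have := norm_sub_le_norm_sub_add_norm_sub y z b
          linarith
        have hPy : P y = x' := by
          refine D.uniq x' p' ?_ ?_ hT ?_
          · have := norm_sub_le_norm_sub_add_norm_sub x' (P z) xb
            linarith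
          · have := norm_sub_norm_le p' ((2 * r) • (z - P z))
            linarith
          · have := hball y hyb
            show ‖y - xb‖ ≤ ρ
            linarith
        have h1 := hloc y hyb
        rw [hPy] at h1
        have h2 : ⟪e, y - z⟫ = ⟪e, x' - P z⟫ + c * ⟪e, p' - (2 * r) • (z - P z)⟫ := by
          rw [hyz, inner_add_right, real_inner_smul_right]
        have h3 : C * ‖y - z‖ ^ 2 ≤ ε' * d := by
          have : ‖y - z‖ ^ 2 ≤ ((1 + c) * d) ^ 2 := pow_le_pow_left₀ (norm_nonneg _) hyzn 2
          calc C * ‖y - z‖ ^ 2 ≤ C * ((1 + c) * d) ^ 2 := mul_le_mul_of_nonneg_left this hCpos.le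
            _ = (d * (C * (1 + c) ^ 2)) * d := by ring
            _ ≤ ε' * d := mul_le_mul_of_nonneg_right k4.le hd0
        simp only [inner_sub_left, real_inner_smul_left, inner_neg_left]
        rw [h2] at h1
        have e3 : s / (2 * r) = s * c := by rw [hc]; ring
        rw [e3]
        linarith
      have hn2 := aux_normal_smul (t := 2 * r / s) (by positivity) hn
      have e1 : (2 * r / s) • (h - s • e) = (2 * r) • ((1 / s) • h - e) := by
        have k1 : 2 * r / s * s = 2 * r := by field_simp
        have k2 : 2 * r / s = 2 * r * (1 / s) := by ring
        rw [smul_sub, smul_smul, k1, k2, smul_sub, smul_smul (2 * r) (1 / s) h]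
      have e2 : (2 * r / s) • (-((s / (2 * r)) • e)) = - e := by
        rw [smul_neg, smul_smul]
        have : 2 * r / s * (s / (2 * r)) = 1 := by field_simp
        rw [this, one_smul]
      rw [e1, e2] at hn2
      have h1 := hest z hzρ _ _ hen hn2
      rw [norm_smul, hh, mul_one, Real.norm_of_nonneg (by positivity), lt_div_iff₀ hspos] at h1
      have h2 : (1 + η) * α ≤ (1 + η) * s := by
        refine mul_le_mul_of_nonneg_left ?_ (by positivity)
        have : 0 < 2 * K * a := by positivity
        linarith
      linarith
    intro y hy
    have := hmin' y hy
    rw [hzb, sub_self, norm_zero] at this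
    rw [inner_sub_right]
    simp only [mul_zero, ne_eq, OfNat.ofNat_ne_zero, not_false_eq_true, zero_pow,
          add_zero] at this
    linarith
  set σ := min (R / 2) ((1 - α) / (4 * K)) with hσ
  have h1α : 0 < 1 - α := by linarith
  have hσpos : 0 < σ := by positivity
  have hσ1 : σ ≤ R / 2 := min_le_left _ _
  have hσ2 : σ * (4 * K) ≤ 1 - α := by
    have : σ ≤ (1 - α) / (4 * K) := min_le_right _ _
    rwa [le_div_iff₀ (by positivity)] at this
  refine ⟨(1 + α) / 2, σ, by positivity, by linarith, hσpos, by linarith, ?_⟩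
  intro z b hz hb
  by_cases h0 : P z - P b = 0
  · rw [h0, norm_zero]; positivity
  have hnp : 0 < ‖P z - P b‖ := norm_pos_iff.2 h0
  have hzb : ‖z - b‖ ≤ 2 * σ := by
    have := norm_sub_le_norm_sub_add_norm_sub z xb b
    rw [norm_sub_rev xb b] at this
    linarith
  have h1 := main b (by linarith) ((1 / ‖P z - P b‖) • (P z - P b)) (by
    rw [norm_smul, Real.norm_of_nonneg (by positivity)]; field_simp) z (by linarith)
  rw [real_inner_smul_left, real_inner_self_eq_norm_sq] at h1
  have e1 : 1 / ‖P z - P b‖ * ‖P z - P b‖ ^ 2 = ‖P z - P b‖ := by field_simp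
  rw [e1] at h1
  have h2 : K * ‖z - b‖ ^ 2 ≤ (1 - α) / 2 * ‖z - b‖ := by
    have : K * ‖z - b‖ ≤ (1 - α) / 2 := by nlinarith
    calc K * ‖z - b‖ ^ 2 = (K * ‖z - b‖) * ‖z - b‖ := by ring
      _ ≤ _ := mul_le_mul_of_nonneg_right this (norm_nonneg _)
  linarith

/-- Consequences of tilt stability: the local inverse of the subdifferential. -/
structure TiltData (f : X → EReal) (xb : X) (ρ K σ : ℝ) (m : X → X) : Prop where
  rho_pos : 0 < ρ
  K_pos : 0 < K
  sig_pos : 0 < σ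
  zero : m 0 = xb
  mem : ∀ p, ‖p‖ ≤ ρ → p ∈ LimitingSubdiff f (m p)
  lip : ∀ p q, ‖p‖ ≤ ρ → ‖q‖ ≤ ρ → ‖m p - m q‖ ≤ K * ‖p - q‖
  coco : ∀ p q, ‖p‖ ≤ ρ → ‖q‖ ≤ ρ → σ * ‖m p - m q‖ ^ 2 ≤ ⟪p - q, m p - m q⟫
  uniq : ∀ x p, ‖x - xb‖ ≤ ρ → ‖p‖ ≤ ρ → p ∈ LimitingSubdiff f x → x = m p

/-- Solving `m q + c • q = z` for a monotone Lipschitz map `m`. -/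
theorem aux_solve [ProperSpace X] (m : X → X) (xb : X) (K c R : ℝ) (hKpos : 0 < K)
    (hcpos : 0 < c) (hRpos : 0 < R) (hm0 : m 0 = xb)
    (hlip' : ∀ p q, ‖p‖ ≤ R → ‖q‖ ≤ R → ‖m p - m q‖ ≤ K * ‖p - q‖)
    (hmono : ∀ p q, ‖p‖ ≤ R → ‖q‖ ≤ R → 0 ≤ ⟪p - q, m p - m q⟫) :
    ∃ κ > 0, ∀ z, ‖z - xb‖ ≤ κ → ∃ q, ‖q‖ ≤ R ∧ m q + c • q = z := by
  set S := K + c with hS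
  have hSpos : 0 < S := by positivity
  set k := c / S with hk
  have hkpos : 0 < k := by positivity
  have hk1 : k < 1 := by rw [hk, div_lt_one hSpos]; linarith
  set τ := k / S with hτ
  have hτpos : 0 < τ := by positivity
  have hτc : τ * c = k ^ 2 := by rw [hτ, hk]; field_simp
  have hτS : τ * S = k := by rw [hτ]; field_simp
  set κ := (k ^ 2 / 2) * R / τ with hκ
  have hκpos : 0 < κ := by positivity
  have hκτ : τ * κ = (k ^ 2 / 2) * R := by rw [hκ]; field_simp
  refine ⟨κ, hκpos, ?_⟩
  · intro z hz
    have hΦ : ∀ q q' : X, ‖q - 0‖ ≤ R → ‖q' - 0‖ ≤ R →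
        ‖(q - τ • (m q + c • q - z)) - (q' - τ • (m q' + c • q' - z))‖
          ≤ (1 - k ^ 2 / 2) * ‖q - q'‖ := by
      intro q q' hq hq'
      rw [sub_zero] at hq hq'
      have e1 : (q - τ • (m q + c • q - z)) - (q' - τ • (m q' + c • q' - z))
          = (q - q') - τ • ((m q - m q') + c • (q - q')) := by
        module
      rw [e1]
      have hl := hlip' q q' hq hq'
      have hcc : 0 ≤ ⟪q - q', m q - m q'⟫ := hmono q q' hq hq'
      set d := q - q' with hd
      set M := m q - m q' with hM
      have hn : ‖M + c • d‖ ≤ S * ‖d‖ := by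
        refine (norm_add_le _ _).trans ?_
        rw [norm_smul, Real.norm_of_nonneg hcpos.le, hS]
        linarith
      have hn2 : (τ * ‖M + c • d‖) ^ 2 ≤ (k * ‖d‖) ^ 2 := by
        refine pow_le_pow_left₀ (by positivity) ?_ 2
        rw [← hτS, mul_assoc]
        exact mul_le_mul_of_nonneg_left hn hτpos.le
      have h1 : ‖d - τ • (M + c • d)‖ ^ 2 ≤ ((1 - k ^ 2 / 2) * ‖d‖) ^ 2 := by
        rw [norm_sub_sq_real, real_inner_smul_right, inner_add_right, real_inner_smul_right,
          real_inner_self_eq_norm_sq, norm_smul, Real.norm_of_nonneg hτpos.le]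
        have h2 : τ * (⟪d, M⟫ + c * ‖d‖ ^ 2) = τ * ⟪d, M⟫ + k ^ 2 * ‖d‖ ^ 2 := by
          rw [← hτc]; ring
        have h3 : 0 ≤ τ * ⟪d, M⟫ := by positivity
        rw [h2]
        have h4 : 0 ≤ (k ^ 2 / 2) ^ 2 * ‖d‖ ^ 2 := by positivity
        nlinarith
      refine le_of_sq_le_sq h1 ?_
      have : 0 ≤ 1 - k ^ 2 / 2 := by nlinarith
      positivity
    obtain ⟨q, hq, hfix⟩ := aux_fixed (fun q => q - τ • (m q + c • q - z)) 0 R (1 - k ^ 2 / 2)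
      hRpos.le (by have : 0 < k ^ 2 := by positivity
                   linarith) (by
        intro q hq
        have h1 := hΦ q 0 hq (by simpa using hRpos.le)
        have h2 : ‖(0 : X) - τ • (m 0 + c • (0 : X) - z)‖ ≤ (k ^ 2 / 2) * R := by
          rw [hm0, smul_zero, add_zero, zero_sub, norm_neg, norm_smul,
            Real.norm_of_nonneg hτpos.le, norm_sub_rev, ← hκτ]
          exact mul_le_mul_of_nonneg_left hz hτpos.le
        have h3 := norm_sub_norm_le (q - τ • (m q + c • q - z))
          ((0 : X) - τ • (m 0 + c • (0 : X) - z))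
        have h4 : (1 - k ^ 2 / 2) * ‖q - 0‖ ≤ (1 - k ^ 2 / 2) * R :=
          mul_le_mul_of_nonneg_left hq (by nlinarith)
        show ‖q - τ • (m q + c • q - z) - 0‖ ≤ R
        rw [sub_zero]
        linarith) hΦ
    refine ⟨q, by simpa using hq, ?_⟩
    have h1 : τ • (m q + c • q - z) = 0 := by
      have : q - τ • (m q + c • q - z) = q := hfix
      exact sub_eq_self.1 this
    rcases smul_eq_zero.1 h1 with h2 | h2
    · exact absurd h2 hτpos.ne'
    · exact sub_eq_zero.1 h2

theorem aux_tilt_data [ProperSpace X] {f : X → EReal} (hbot : ∀ x, f x ≠ ⊥)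
    {xb : X} (hxb : f xb ≠ ⊤) {r ε : ℝ} (H : PRS f xb r ε) (hT : TiltStable f xb) :
    ∃ ρ K σ m, TiltData f xb ρ K σ m := by
  have hr := H.1
  have hε := H.2.1
  obtain ⟨γ, hγ, V, hV, m, K0, hm, hlip, hm0⟩ := hT
  obtain ⟨ρ0, hρ0, hρV⟩ := Metric.nhds_basis_closedBall.mem_iff.1 hV
  set K : ℝ := (K0 : ℝ) + 1 with hK
  have hKpos : 0 < K := by positivity
  have hinV : ∀ p, ‖p‖ ≤ ρ0 → p ∈ V := fun p hp => hρV (by simpa using hp)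
  have hlip' : ∀ p q, ‖p‖ ≤ ρ0 → ‖q‖ ≤ ρ0 → ‖m p - m q‖ ≤ K * ‖p - q‖ := by
    intro p q hp hq
    have := hlip.dist_le_mul p (hinV p hp) q (hinV q hq)
    rw [dist_eq_norm, dist_eq_norm] at this
    have h2 := norm_nonneg (p - q)
    rw [hK]
    linarith
  have hmin : ∀ p, ‖p‖ ≤ ρ0 → ‖m p - xb‖ ≤ γ ∧ f (m p) ≠ ⊤ ∧
      ∀ y, ‖y - xb‖ ≤ γ → f y ≠ ⊤ →
        (f (m p)).toReal - ⟪p, m p⟫ ≤ (f y).toReal - ⟪p, y⟫ := by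
    intro p hp
    have h1 : m p ∈ TiltArgmin f xb γ p := by rw [hm p (hinV p hp)]; rfl
    exact (aux_mem_tilt hbot hxb hγ p (m p)).1 h1
  set R := min (min (ρ0 / 2) (γ / (2 * K))) (min ε (ε / K)) with hR
  have hRpos : 0 < R := by positivity
  have hR1 : R ≤ ρ0 / 2 := (min_le_left _ _).trans (min_le_left _ _)
  have hR2 : K * R ≤ γ / 2 := by
    have : R ≤ γ / (2 * K) := (min_le_left _ _).trans (min_le_right _ _)
    rw [le_div_iff₀ (by positivity)] at this
    linarith
  have hR3 : R ≤ ε := (min_le_right _ _).trans (min_le_left _ _)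
  have hR4 : K * R ≤ ε := by
    have : R ≤ ε / K := (min_le_right _ _).trans (min_le_right _ _)
    rw [le_div_iff₀ (by positivity)] at this
    linarith
  have hnear : ∀ p, ‖p‖ ≤ R → ‖m p - xb‖ ≤ K * R := by
    intro p hp
    have := hlip' p 0 (by linarith) (by simpa using hρ0.le)
    rw [hm0, sub_zero] at this
    exact this.trans (mul_le_mul_of_nonneg_left hp hKpos.le)
  have hmem : ∀ p, ‖p‖ ≤ R → p ∈ LimitingSubdiff f (m p) := by
    intro p hp
    obtain ⟨h1, h2, h3⟩ := hmin p (by linarith)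
    refine aux_mem_subdiff hbot (δ := γ / 2) (C := 0) (by positivity) h2 ?_
    intro y hy hyt
    have h4 := hnear p hp
    have h5 := norm_sub_le_norm_sub_add_norm_sub y (m p) xb
    have h6 := h3 y (by linarith) hyt
    rw [inner_sub_right]
    linarith
  have hgrow : ∀ p q, ‖p‖ ≤ R → ‖q‖ ≤ R →
      (f (m p)).toReal + ⟪p, m q - m p⟫ + 1 / (4 * K) * ‖m q - m p‖ ^ 2 ≤ (f (m q)).toReal := by
    intro p q hp hq
    set τ := 1 / (2 * K) with hτ
    have hτpos : 0 < τ := by positivity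
    set q' := p + τ • (m q - m p) with hq'
    have hqp : q' - p = τ • (m q - m p) := by rw [hq']; abel
    have hqpn : ‖q' - p‖ = τ * ‖m q - m p‖ := by
      rw [hqp, norm_smul, Real.norm_of_nonneg hτpos.le]
    have hl := hlip' q p (by linarith) (by linarith)
    have hqpR : ‖q' - p‖ ≤ R := by
      rw [hqpn]
      have h1 : ‖q - p‖ ≤ 2 * R := (norm_sub_le _ _).trans (by linarith)
      have h2 : τ * ‖m q - m p‖ ≤ τ * (K * (2 * R)) := by
        refine mul_le_mul_of_nonneg_left (hl.trans ?_) hτpos.le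
        exact mul_le_mul_of_nonneg_left h1 hKpos.le
      have h3 : τ * (K * (2 * R)) = R := by rw [hτ]; field_simp
      linarith
    have hq'n : ‖q'‖ ≤ ρ0 := by
      have : q' = (q' - p) + p := by abel
      rw [this]
      exact (norm_add_le _ _).trans (by linarith)
    obtain ⟨a1, a2, a3⟩ := hmin q' hq'n
    obtain ⟨b1, b2, b3⟩ := hmin p (by linarith)
    obtain ⟨c1, c2, -⟩ := hmin q (by linarith)
    have h1 := a3 (m q) c1 c2
    have h2 := b3 (m q') a1 a2
    have h3 : ⟪q' - p, m q' - m p⟫ ≤ K * ‖q' - p‖ ^ 2 := by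
      refine (real_inner_le_norm _ _).trans ?_
      have := hlip' q' p hq'n (by linarith)
      nlinarith [norm_nonneg (q' - p)]
    have h4 : ⟪q' - p, m q - m p⟫ = τ * ‖m q - m p‖ ^ 2 := by
      rw [hqp, real_inner_smul_left, real_inner_self_eq_norm_sq]
    rw [hqpn] at h3
    simp only [inner_sub_left, inner_sub_right] at h3 h4 ⊢
    have h5 : K * (τ * ‖m q - m p‖) ^ 2 = 1 / (4 * K) * ‖m q - m p‖ ^ 2 := by
      rw [hτ]; field_simp; ring
    have h6 : τ * ‖m q - m p‖ ^ 2 = 1 / (4 * K) * ‖m q - m p‖ ^ 2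
        + 1 / (4 * K) * ‖m q - m p‖ ^ 2 := by
      rw [hτ]; field_simp; ring
    linarith
  have hcoco : ∀ p q, ‖p‖ ≤ R → ‖q‖ ≤ R →
      1 / (2 * K) * ‖m p - m q‖ ^ 2 ≤ ⟪p - q, m p - m q⟫ := by
    intro p q hp hq
    have h1 := hgrow p q hp hq
    have h2 := hgrow q p hq hp
    rw [norm_sub_rev] at h1
    simp only [inner_sub_left, inner_sub_right] at h1 h2 ⊢
    have h6 : 1 / (2 * K) * ‖m p - m q‖ ^ 2 = 1 / (4 * K) * ‖m p - m q‖ ^ 2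
        + 1 / (4 * K) * ‖m p - m q‖ ^ 2 := by
      field_simp; ring
    linarith
  set c := 1 / (2 * r) with hc
  have hcpos : 0 < c := by positivity
  obtain ⟨κ, hκpos, hsolve⟩ := aux_solve m xb K c R hKpos hcpos hRpos hm0
    (fun p q hp hq => hlip' p q (by linarith) (by linarith))
    (fun p q hp hq => le_trans (by positivity) (hcoco p q hp hq))
  refine ⟨min R (κ / (1 + c)), K, 1 / (2 * K), m, by positivity, hKpos, by positivity, hm0,
    fun p hp => hmem p (hp.trans (min_le_left _ _)),
    fun p q hp hq => hlip' p q ?_ ?_,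
    fun p q hp hq => hcoco p q (hp.trans (min_le_left _ _)) (hq.trans (min_le_left _ _)), ?_⟩
  · have := hp.trans (min_le_left _ _); linarith
  · have := hq.trans (min_le_left _ _); linarith
  intro x p hx hp hxp
  have hx1 := hx.trans (min_le_right _ _)
  have hp1 := hp.trans (min_le_right _ _)
  have hx2 := hx.trans (min_le_left _ _)
  have hp2 := hp.trans (min_le_left _ _)
  obtain ⟨q, hq, hqz⟩ := hsolve (x + c • p) (by
    have e : x + c • p - xb = (x - xb) + c • p := by abel
    rw [e]
    refine (norm_add_le _ _).trans ?_
    rw [norm_smul, Real.norm_of_nonneg hcpos.le]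
    have h1 := mul_le_mul_of_nonneg_left hp1 hcpos.le
    have h2 : κ / (1 + c) + c * (κ / (1 + c)) = κ := by field_simp
    linarith)
  have h1 := aux_two_lip H (hx2.trans hR3) (hp2.trans hR3) hxp ((hnear q hq).trans hR4)
    (hq.trans hR3) (hmem q hq)
  rw [← hc, hqz, sub_self, norm_zero, mul_zero] at h1
  have h2 : x = m q := sub_eq_zero.1 (norm_le_zero_iff.1 h1)
  rw [← h2] at hqz
  have h3 : q = p := smul_right_injective X hcpos.ne' (add_left_cancel hqz)
  rw [← h3]; exact h2

theorem aux_pd {f : X → EReal} {xb : X} {ρ K σ : ℝ} {m : X → X}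
    (D : TiltData f xb ρ K σ m) (u w : X) (hw : w ∈ SecondSubdiff f xb 0 u) :
    σ * ‖u‖ ^ 2 ≤ ⟪w, u⟫ := by
  obtain ⟨zs, ws, h1, hz, hwl⟩ := hw
  have hσ := D.sig_pos
  have hKp := D.K_pos
  have key : ∀ x p w v : X, ‖x - xb‖ ≤ ρ → ‖p‖ < ρ → p ∈ LimitingSubdiff f x →
      (w, v) ∈ FrechetNormalP {q : X × X | q.2 ∈ LimitingSubdiff f q.1} (x, p) →
      σ * ‖v‖ ^ 2 ≤ - ⟪w, v⟫ := by
    intro x p w v hx hp hxp hn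
    have hxm := D.uniq x p hx hp.le hxp
    set d := w + (2 * σ) • v with hd
    set B := ‖d‖ * (1 + K) with hB
    have hB0 : 0 ≤ B := by positivity
    refine le_of_forall_pos_le_add ?_
    intro e he
    obtain ⟨δ, hδ, hδn⟩ := hn (e / (B + 1)) (by positivity)
    set t := min (δ / (B + 1)) ((ρ - ‖p‖) / (‖d‖ + 1)) / 2 with ht
    have hρp : 0 < ρ - ‖p‖ := by linarith
    have htpos : 0 < t := by positivity
    have ht1 : t * (B + 1) < δ := by
      have h2 : t < δ / (B + 1) := by
        have := min_le_left (δ / (B + 1)) ((ρ - ‖p‖) / (‖d‖ + 1))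
        have : 0 < δ / (B + 1) := by positivity
        rw [ht]; linarith
      rwa [lt_div_iff₀ (by positivity)] at h2
    have ht2 : t * (‖d‖ + 1) ≤ ρ - ‖p‖ := by
      have h2 : t ≤ (ρ - ‖p‖) / (‖d‖ + 1) := by
        have := min_le_right (δ / (B + 1)) ((ρ - ‖p‖) / (‖d‖ + 1))
        have : 0 < (ρ - ‖p‖) / (‖d‖ + 1) := by positivity
        rw [ht]; linarith
      rwa [le_div_iff₀ (by positivity)] at h2
    have hpt : ‖p + t • d‖ ≤ ρ := by
      refine (norm_add_le _ _).trans ?_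
      rw [norm_smul, Real.norm_of_nonneg htpos.le]
      linarith
    have edp : p + t • d - p = t • d := by abel
    have hl := D.lip (p + t • d) p hpt hp.le
    have hcc := D.coco (p + t • d) p hpt hp.le
    rw [edp, norm_smul, Real.norm_of_nonneg htpos.le] at hl
    rw [edp, real_inner_smul_left] at hcc
    set M := m (p + t • d) - m p with hM
    have hdist : dist (m (p + t • d), p + t • d) (x, p) ≤ t * B := by
      rw [Prod.dist_eq, hxm, dist_eq_norm, dist_eq_norm, edp, ← hM, norm_smul,
        Real.norm_of_nonneg htpos.le, max_le_iff, hB]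
      have : 0 ≤ t * ‖d‖ := by positivity
      constructor <;> nlinarith
    have h3 := hδn (m (p + t • d), p + t • d) (D.mem _ hpt) (lt_of_le_of_lt hdist (by linarith))
    have h4 : e / (B + 1) * dist (m (p + t • d), p + t • d) (x, p) ≤ t * e := by
      refine (mul_le_mul_of_nonneg_left hdist (by positivity)).trans ?_
      rw [div_mul_eq_mul_div, div_le_iff₀ (by positivity)]
      have : 0 ≤ t * e := by positivity
      nlinarith
    have h5 := h3.trans h4
    rw [hxm] at h5
    simp only [edp, ← hM] at h5
    rw [real_inner_smul_right] at h5
    have h6 : ⟪d, M⟫ = ⟪w, M⟫ + 2 * σ * ⟪v, M⟫ := by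
      rw [hd, inner_add_left, real_inner_smul_left]
    have h7 : ⟪v, d⟫ = ⟪w, v⟫ + 2 * σ * ‖v‖ ^ 2 := by
      rw [hd, inner_add_right, real_inner_smul_right, real_inner_self_eq_norm_sq, real_inner_comm]
    have h8 : 0 ≤ ‖M - t • v‖ ^ 2 := by positivity
    rw [norm_sub_sq_real, real_inner_smul_right, norm_smul, Real.norm_of_nonneg htpos.le,
      real_inner_comm] at h8
    rw [h6] at hcc
    rw [h7] at h5
    -- lower bound for `⟪w, M⟫`
    have h9 : - (σ * t * ‖v‖ ^ 2) ≤ ⟪w, M⟫ := by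
      have h10 : 0 ≤ σ * (‖M‖ ^ 2 - 2 * (t * ⟪v, M⟫) + (t * ‖v‖) ^ 2) := mul_nonneg hσ.le h8
      have h11 : t * (- (σ * t * ‖v‖ ^ 2)) ≤ t * ⟪w, M⟫ := by nlinarith
      exact le_of_mul_le_mul_left h11 htpos
    have h12 : t * (σ * ‖v‖ ^ 2) ≤ t * (- ⟪w, v⟫ + e) := by nlinarith
    exact le_of_mul_le_mul_left h12 htpos
  have hz1 : Tendsto (fun k => (zs k).1) atTop (𝓝 xb) := (continuous_fst.tendsto _).comp hz
  have hz2 : Tendsto (fun k => (zs k).2) atTop (𝓝 0) := (continuous_snd.tendsto _).comp hz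
  have hw1 : Tendsto (fun k => (ws k).1) atTop (𝓝 w) := (continuous_fst.tendsto _).comp hwl
  have hw2 : Tendsto (fun k => (ws k).2) atTop (𝓝 (-u)) := (continuous_snd.tendsto _).comp hwl
  have hev : ∀ᶠ k in atTop, σ * ‖(ws k).2‖ ^ 2 ≤ - ⟪(ws k).1, (ws k).2⟫ := by
    have e1 := hz1.eventually (Metric.closedBall_mem_nhds xb D.rho_pos)
    have e2 := hz2.eventually (Metric.ball_mem_nhds 0 D.rho_pos)
    filter_upwards [e1, e2] with k hk1 hk2
    refine key (zs k).1 (zs k).2 _ _ ?_ ?_ (h1 k).1 (h1 k).2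
    · simpa [dist_eq_norm] using hk1
    · simpa using hk2
  have := le_of_tendsto_of_tendsto ((hw2.norm.pow 2).const_mul σ) (hw1.inner hw2).neg hev
  simpa using this

theorem aux_mr {f : X → EReal} {xb : X} {ρ K σ : ℝ} {m : X → X}
    (D : TiltData f xb ρ K σ m) :
    StronglyMetricallyRegularAround (LimitingSubdiff f) xb (0 : X) (K + 1) := by
  have hρ := D.rho_pos
  have hK := D.K_pos
  refine ⟨⟨closedBall xb (ρ / 2), closedBall_mem_nhds _ (by positivity), closedBall 0 (ρ / 2),
    closedBall_mem_nhds _ (by positivity), ?_⟩, closedBall 0 (min ρ (ρ / K)),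
    closedBall_mem_nhds _ (by positivity), closedBall xb ρ, closedBall_mem_nhds _ hρ, ?_⟩
  · intro x hx y hy
    rw [mem_closedBall, dist_eq_norm] at hx
    rw [mem_closedBall, dist_zero_right] at hy
    have hy' : ‖y‖ ≤ ρ := by linarith
    have hle : Metric.infEDist x {z | y ∈ LimitingSubdiff f z} ≤ edist x (m y) :=
      Metric.infEDist_le_edist_of_mem (D.mem y hy')
    refine le_trans hle ?_
    have hk0 : ENNReal.ofReal (K + 1) ≠ 0 := by
      rw [ne_eq, ENNReal.ofReal_eq_zero]; linarith
    rw [mul_comm, ← ENNReal.div_le_iff hk0 ENNReal.ofReal_ne_top]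
    refine Metric.le_infEDist.2 ?_
    intro p hp
    rw [ENNReal.div_le_iff hk0 ENNReal.ofReal_ne_top, edist_dist, edist_dist,
      ← ENNReal.ofReal_mul dist_nonneg]
    refine ENNReal.ofReal_le_ofReal ?_
    rw [dist_eq_norm, dist_eq_norm]
    by_cases hpρ : ‖p‖ ≤ ρ
    · have hxm := D.uniq x p (by linarith) hpρ hp
      rw [hxm]
      have := D.lip p y hpρ hy'
      rw [norm_sub_rev p y] at this
      have h2 := norm_nonneg (y - p)
      linarith
    · push Not at hpρ
      have h1 : ρ / 2 ≤ ‖y - p‖ := by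
        have := norm_sub_norm_le p y
        rw [norm_sub_rev p y] at this
        linarith
      have h2 : ‖x - m y‖ ≤ (K + 1) * (ρ / 2) := by
        have h3 := D.lip 0 y (by simpa using hρ.le) hy'
        rw [D.zero, zero_sub, norm_neg] at h3
        have h4 := norm_sub_le_norm_sub_add_norm_sub x xb (m y)
        have h5 := mul_le_mul_of_nonneg_left hy hK.le
        linarith
      have h3 : (ρ / 2) * (K + 1) ≤ ‖y - p‖ * (K + 1) :=
        mul_le_mul_of_nonneg_right h1 (by positivity)
      linarith
  · intro y hy
    rw [mem_closedBall, dist_zero_right] at hy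
    have hy1 := hy.trans (min_le_left _ _)
    have hy2 := hy.trans (min_le_right _ _)
    rw [le_div_iff₀ hK] at hy2
    refine ⟨m y, ⟨?_, D.mem y hy1⟩, ?_⟩
    · rw [mem_closedBall, dist_eq_norm]
      have h3 := D.lip y 0 hy1 (by simpa using hρ.le)
      rw [D.zero, sub_zero] at h3
      linarith
    · rintro x ⟨hx, hxy⟩
      rw [mem_closedBall, dist_eq_norm] at hx
      exact D.uniq x y hx hy1 hxy

theorem aux_mr_point {F : X → Set X} {U V : Set X} {κ : ℝ} (hκ : 0 < κ)
    (h : ∀ x ∈ U, ∀ y ∈ V,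
      Metric.infEDist x {z | y ∈ F z} ≤ ENNReal.ofReal κ * Metric.infEDist y (F x))
    {x y p : X} (hx : x ∈ U) (hy : y ∈ V) (hp : p ∈ F x) :
    ∃ z, y ∈ F z ∧ ‖x - z‖ ≤ 2 * κ * ‖y - p‖ := by
  by_cases hyp : y = p
  · refine ⟨x, hyp ▸ hp, ?_⟩
    rw [sub_self, norm_zero]; positivity
  have hpos : 0 < ‖y - p‖ := norm_pos_iff.2 (sub_ne_zero.2 hyp)
  have h1 : Metric.infEDist x {z | y ∈ F z} < ENNReal.ofReal (2 * κ * ‖y - p‖) := by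
    calc Metric.infEDist x {z | y ∈ F z} ≤ ENNReal.ofReal κ * Metric.infEDist y (F x) := h x hx y hy
      _ ≤ ENNReal.ofReal κ * edist y p := by
          gcongr
          exact Metric.infEDist_le_edist_of_mem hp
      _ = ENNReal.ofReal (κ * ‖y - p‖) := by
          rw [edist_dist, dist_eq_norm, ENNReal.ofReal_mul hκ.le]
      _ < ENNReal.ofReal (2 * κ * ‖y - p‖) := by
          rw [ENNReal.ofReal_lt_ofReal_iff (by positivity)]
          nlinarith [mul_pos hκ hpos]
  obtain ⟨z, hz, hd⟩ := Metric.infEDist_lt_iff.1 h1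
  refine ⟨z, hz, ?_⟩
  rw [edist_dist, dist_eq_norm, ENNReal.ofReal_lt_ofReal_iff (by positivity)] at hd
  exact hd.le

theorem aux_ker {f : X → EReal} {xb : X} {κ : ℝ} (hκ : 0 < κ)
    (hmr : MetricallyRegularAround (LimitingSubdiff f) xb (0 : X) κ) (u : X)
    (hu : (0 : X) ∈ SecondSubdiff f xb 0 u) : u = 0 := by
  obtain ⟨U, hU, V, hV, hUV⟩ := hmr
  obtain ⟨ρ, hρ, hρV⟩ := Metric.nhds_basis_ball.mem_iff.1 hV
  obtain ⟨zs, ws, h1, hz, hwl⟩ := hu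
  have key : ∀ x p w v : X, x ∈ U → ‖p‖ < ρ → p ∈ LimitingSubdiff f x →
      (w, v) ∈ FrechetNormalP {q : X × X | q.2 ∈ LimitingSubdiff f q.1} (x, p) →
      ‖v‖ ≤ 2 * κ * ‖w‖ := by
    intro x p w v hx hp hxp hn
    by_cases hv : v = 0
    · rw [hv, norm_zero]; positivity
    have hvpos : 0 < ‖v‖ := norm_pos_iff.2 hv
    refine le_of_forall_pos_le_add ?_
    intro e he
    obtain ⟨δ, hδ, hδn⟩ := hn (e / (2 * κ + 1)) (by positivity)
    have hρp : 0 < ρ - ‖p‖ := by linarith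
    set t := min (δ / ((2 * κ + 1) * ‖v‖)) ((ρ - ‖p‖) / ‖v‖) / 2 with ht
    have htpos : 0 < t := by positivity
    have ht1 : t * ((2 * κ + 1) * ‖v‖) < δ := by
      rw [← lt_div_iff₀ (by positivity)]
      have := min_le_left (δ / ((2 * κ + 1) * ‖v‖)) ((ρ - ‖p‖) / ‖v‖)
      have : 0 < δ / ((2 * κ + 1) * ‖v‖) := by positivity
      rw [ht]; linarith
    have ht2 : t * ‖v‖ < ρ - ‖p‖ := by
      rw [← lt_div_iff₀ (by positivity)]
      have := min_le_right (δ / ((2 * κ + 1) * ‖v‖)) ((ρ - ‖p‖) / ‖v‖)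
      have : 0 < (ρ - ‖p‖) / ‖v‖ := by positivity
      rw [ht]; linarith
    have edp : p + t • v - p = t • v := by abel
    have hpt : p + t • v ∈ V := by
      apply hρV
      rw [mem_ball, dist_zero_right]
      refine lt_of_le_of_lt (norm_add_le _ _) ?_
      rw [norm_smul, Real.norm_of_nonneg htpos.le]
      linarith
    obtain ⟨x', hx', hxx'⟩ := aux_mr_point hκ hUV hx hpt hxp
    rw [edp, norm_smul, Real.norm_of_nonneg htpos.le] at hxx'
    have htv : 0 < t * ‖v‖ := by positivity
    have hdist : dist (x', p + t • v) (x, p) ≤ t * ((2 * κ + 1) * ‖v‖) := by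
      rw [Prod.dist_eq, dist_comm, dist_eq_norm, dist_eq_norm, edp, norm_smul,
        Real.norm_of_nonneg htpos.le, max_le_iff]
      constructor
      · show ‖x - x'‖ ≤ _
        nlinarith
      · nlinarith
    have h3 := hδn (x', p + t • v) hx' (lt_of_le_of_lt hdist ht1)
    have h4 : e / (2 * κ + 1) * dist (x', p + t • v) (x, p) ≤ e * (t * ‖v‖) := by
      refine (mul_le_mul_of_nonneg_left hdist (by positivity)).trans (le_of_eq ?_)
      field_simp
    have h5 := h3.trans h4
    simp only [edp] at h5
    rw [real_inner_smul_right, real_inner_self_eq_norm_sq] at h5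
    have h6 : - (‖w‖ * (2 * κ * (t * ‖v‖))) ≤ ⟪w, x' - x⟫ := by
      have h7 := neg_le_of_abs_le (abs_real_inner_le_norm w (x' - x))
      rw [norm_sub_rev x' x] at h7
      have h8 := mul_le_mul_of_nonneg_left hxx' (norm_nonneg w)
      linarith
    have h9 : (t * ‖v‖) * ‖v‖ ≤ (t * ‖v‖) * (2 * κ * ‖w‖ + e) := by nlinarith
    exact le_of_mul_le_mul_left h9 htv
  have hz1 : Tendsto (fun k => (zs k).1) atTop (𝓝 xb) := (continuous_fst.tendsto _).comp hz
  have hz2 : Tendsto (fun k => (zs k).2) atTop (𝓝 0) := (continuous_snd.tendsto _).comp hz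
  have hw1 : Tendsto (fun k => (ws k).1) atTop (𝓝 0) := (continuous_fst.tendsto _).comp hwl
  have hw2 : Tendsto (fun k => (ws k).2) atTop (𝓝 (-u)) := (continuous_snd.tendsto _).comp hwl
  have hev : ∀ᶠ k in atTop, ‖(ws k).2‖ ≤ 2 * κ * ‖(ws k).1‖ := by
    have e1 := hz1.eventually hU
    have e2 := hz2.eventually (Metric.ball_mem_nhds 0 hρ)
    filter_upwards [e1, e2] with k hk1 hk2
    refine key (zs k).1 (zs k).2 _ _ hk1 ?_ (h1 k).1 (h1 k).2
    simpa using hk2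
  have := le_of_tendsto_of_tendsto hw2.norm (hw1.norm.const_mul (2 * κ)) hev
  simpa using this

theorem aux_tilt_of_strong [ProperSpace X] {f : X → EReal} (hbot : ∀ x, f x ≠ ⊥)
    (hlsc : LowerSemicontinuous f) {xb : X} (hxb : f xb ≠ ⊤)
    (h0 : (0 : X) ∈ LimitingSubdiff f xb) {κ : ℝ} (hκ : 0 < κ)
    (hs : StronglyMetricallyRegularAround (LimitingSubdiff f) xb (0 : X) κ)
    (hloc : ∃ U ∈ 𝓝 xb, ∀ x ∈ U, f xb ≤ f x) : TiltStable f xb := by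
  obtain ⟨⟨U3, hU3, V3, hV3, hmr⟩, V2, hV2, U2, hU2, hex⟩ := hs
  obtain ⟨U1, hU1, hmin⟩ := hloc
  obtain ⟨g, hg, hgU⟩ := Metric.nhds_basis_closedBall.mem_iff.1
    (Filter.inter_mem hU1 (Filter.inter_mem hU2 hU3))
  obtain ⟨v, hv, hvV⟩ := Metric.nhds_basis_closedBall.mem_iff.1 (Filter.inter_mem hV2 hV3)
  have hgU' : ∀ x, ‖x - xb‖ ≤ g → x ∈ U1 ∧ x ∈ U2 ∧ x ∈ U3 := by
    intro x hx
    exact hgU (by rw [mem_closedBall, dist_eq_norm]; exact hx)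
  have hvV' : ∀ p, ‖p‖ ≤ v → p ∈ V2 ∧ p ∈ V3 := by
    intro p hp
    exact hvV (by rw [mem_closedBall, dist_zero_right]; exact hp)
  have huniq : ∀ p x y, ‖p‖ ≤ v → ‖x - xb‖ ≤ g → ‖y - xb‖ ≤ g → p ∈ LimitingSubdiff f x →
      p ∈ LimitingSubdiff f y → x = y := by
    intro p x y hp hx hy hpx hpy
    exact (hex p (hvV' p hp).1).unique ⟨(hgU' x hx).2.1, hpx⟩ ⟨(hgU' y hy).2.1, hpy⟩
  have hminR : ∀ y, ‖y - xb‖ ≤ g → f y ≠ ⊤ → (f xb).toReal ≤ (f y).toReal := by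
    intro y hy hyt
    exact EReal.toReal_le_toReal (hmin y (hgU' y hy).1) (hbot xb) hyt
  set γ := g / 2 with hγ
  have hγpos : 0 < γ := by positivity
  have hstrict : ∀ y, ‖y - xb‖ ≤ γ → y ≠ xb → f y ≠ ⊤ → (f xb).toReal < (f y).toReal := by
    intro y hy hne hyt
    refine lt_of_le_of_ne (hminR y (by linarith) hyt) ?_
    intro heq
    apply hne
    refine huniq 0 y xb (by simpa using hv.le) (by linarith) (by simpa using hg.le) ?_ h0
    refine aux_mem_subdiff hbot (δ := γ) (C := 0) hγpos hyt ?_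
    intro y' hy' hyt'
    have h1 := norm_sub_le_norm_sub_add_norm_sub y' y xb
    have h2 := hminR y' (by linarith) hyt'
    rw [inner_zero_left]
    linarith
  set η := γ / 2 with hη
  have hηpos : 0 < η := by positivity
  have hgap : ∃ ν > 0, ∀ y, ‖y - xb‖ ≤ γ → η ≤ ‖y - xb‖ → f y ≠ ⊤ →
      (f xb).toReal + ν ≤ (f y).toReal := by
    by_cases hx0 : ∃ x0, ‖x0 - xb‖ ≤ γ ∧ η ≤ ‖x0 - xb‖ ∧ f x0 ≠ ⊤
    · obtain ⟨x0, a1, a2, a3⟩ := hx0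
      have hcl : IsClosed {y : X | η ≤ ‖y - xb‖} :=
        isClosed_le continuous_const (by fun_prop)
      obtain ⟨x, ⟨hx1, hx2⟩, hxt, hx⟩ := aux_exists_min hbot hlsc
        ((isCompact_closedBall xb γ).inter_right hcl) (x0 := x0)
        ⟨by rw [mem_closedBall, dist_eq_norm]; exact a1, a2⟩ a3 (fun _ => 0) continuous_const
      rw [mem_closedBall, dist_eq_norm] at hx1
      have hx2' : η ≤ ‖x - xb‖ := hx2
      have hne : x ≠ xb := by
        intro h
        rw [h, sub_self, norm_zero] at hx2'
        linarith
      refine ⟨(f x).toReal - (f xb).toReal, by linarith [hstrict x hx1 hne hxt], ?_⟩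
      intro y hy1 hy2 hyt
      have := hx y ⟨by rw [mem_closedBall, dist_eq_norm]; exact hy1, hy2⟩ hyt
      linarith
    · push Not at hx0
      exact ⟨1, one_pos, fun y hy1 hy2 hyt => absurd (hx0 y hy1 hy2) hyt⟩
  obtain ⟨ν, hν, hgap⟩ := hgap
  set τ := min v (min (ν / (2 * γ)) (g / (8 * κ))) with hτ
  have hτpos : 0 < τ := by positivity
  have hτ1 : τ ≤ v := min_le_left _ _
  have hτ2 : τ * (2 * γ) ≤ ν := by
    rw [← le_div_iff₀ (by positivity)]
    exact (min_le_right _ _).trans (min_le_left _ _)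
  have hτ3 : τ * (8 * κ) ≤ g := by
    rw [← le_div_iff₀ (by positivity)]
    exact (min_le_right _ _).trans (min_le_right _ _)
  have hprop : ∀ p x, ‖p‖ ≤ τ → x ∈ TiltArgmin f xb γ p →
      ‖x - xb‖ < η ∧ p ∈ LimitingSubdiff f x := by
    intro p x hp hx
    obtain ⟨h1, h2, h3⟩ := (aux_mem_tilt hbot hxb hγpos p x).1 hx
    have h4 : ‖x - xb‖ < η := by
      by_contra hcon
      push Not at hcon
      have h5 := hgap x h1 hcon h2
      have h6 := h3 xb (by simpa using hγpos.le) hxb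
      have h7 : ⟪p, x - xb⟫ ≤ τ * γ :=
        (real_inner_le_norm _ _).trans (mul_le_mul hp h1 (norm_nonneg _) hτpos.le)
      rw [inner_sub_right] at h7
      have : 0 < τ * γ := by positivity
      linarith
    refine ⟨h4, aux_mem_subdiff hbot (δ := η) (C := 0) hηpos h2 ?_⟩
    intro y hy hyt
    have h5 := norm_sub_le_norm_sub_add_norm_sub y x xb
    have h6 := h3 y (by linarith) hyt
    rw [inner_sub_right]
    linarith
  have hexm : ∀ p, ∃ x, x ∈ TiltArgmin f xb γ p := by
    intro p
    obtain ⟨x, hx1, hxt, hx⟩ := aux_exists_min hbot hlsc (isCompact_closedBall xb γ)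
      (mem_closedBall_self hγpos.le) hxb (fun y => - ⟪p, y⟫) (by fun_prop)
    simp only [mem_closedBall, dist_eq_norm] at hx1 hx
    refine ⟨x, (aux_mem_tilt hbot hxb hγpos p x).2 ⟨hx1, hxt, fun y hy hyt => ?_⟩⟩
    have := hx y hy hyt
    linarith
  choose m hm using hexm
  refine ⟨γ, hγpos, closedBall 0 τ, closedBall_mem_nhds _ hτpos, m, Real.toNNReal (2 * κ),
    ?_, ?_, ?_⟩
  · intro p hp
    rw [mem_closedBall, dist_zero_right] at hp
    ext x
    rw [Set.mem_singleton_iff]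
    constructor
    · intro hx
      obtain ⟨a1, a2⟩ := hprop p x hp hx
      obtain ⟨b1, b2⟩ := hprop p (m p) hp (hm p)
      exact huniq p x (m p) (by linarith) (by linarith) (by linarith) a2 b2
    · rintro rfl
      exact hm p
  · refine LipschitzOnWith.of_dist_le_mul ?_
    intro p hp q hq
    rw [mem_closedBall, dist_zero_right] at hp hq
    rw [dist_eq_norm, dist_eq_norm, Real.coe_toNNReal _ (by positivity)]
    obtain ⟨a1, a2⟩ := hprop p (m p) hp (hm p)
    obtain ⟨b1, b2⟩ := hprop q (m q) hq (hm q)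
    obtain ⟨z, hz, hzn⟩ := aux_mr_point hκ hmr (hgU' (m p) (by linarith)).2.2
      (hvV' q (by linarith)).2 a2
    rw [norm_sub_rev q p] at hzn
    have hpq : ‖p - q‖ ≤ 2 * τ := (norm_sub_le _ _).trans (by linarith)
    have hzb : ‖z - xb‖ ≤ g := by
      have h1 := norm_sub_le_norm_sub_add_norm_sub z (m p) xb
      rw [norm_sub_rev z (m p)] at h1
      have h2 : 2 * κ * ‖p - q‖ ≤ 2 * κ * (2 * τ) := mul_le_mul_of_nonneg_left hpq (by positivity)
      linarith
    have hzq : z = m q := huniq q z (m q) (by linarith) hzb (by linarith) hz b2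
    rw [hzq] at hzn
    exact hzn
  · obtain ⟨a1, a2⟩ := hprop 0 (m 0) (by simpa using hτpos.le) (hm 0)
    exact huniq 0 (m 0) xb (by simpa using hv.le) (by linarith) (by simpa using hg.le) a2 h0

theorem aux_locmin_of_tilt {f : X → EReal} {xb : X} (hT : TiltStable f xb) :
    ∃ U ∈ 𝓝 xb, ∀ x ∈ U, f xb ≤ f x := by
  obtain ⟨γ, hγ, V, hV, m, K0, hm, hlip, hm0⟩ := hT
  refine ⟨closedBall xb γ, closedBall_mem_nhds _ hγ, fun x hx => ?_⟩
  have h1 : xb ∈ TiltArgmin f xb γ 0 := by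
    rw [hm 0 (mem_of_mem_nhds hV), hm0]; rfl
  have := h1.2 x hx
  simpa using this

theorem aux_zero_mem {f : X → EReal} {xb : X} (h0 : (0 : X) ∈ LimitingSubdiff f xb) :
    (0 : X) ∈ SecondSubdiff f xb 0 0 := by
  refine ⟨fun _ => (xb, 0), fun _ => (0, -0), fun k => ⟨h0, ?_⟩, tendsto_const_nhds,
    tendsto_const_nhds⟩
  intro ε hε
  refine ⟨1, one_pos, fun z hz hd => ?_⟩
  simp only [neg_zero, inner_zero_left, add_zero]
  positivity

/-- Theorem 4.12: equivalent second-order conditions for prox-regular functions in finite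
dimensions; each is equivalent to tilt stability of the local minimizer. -/
theorem equivalent_second_order_conditions (n : ℕ)
    (f : EuclideanSpace ℝ (Fin n) → EReal)
    (hproper : ∃ x, f x ≠ ⊤) (hbot : ∀ x, f x ≠ ⊥) (hlsc : LowerSemicontinuous f)
    (xb : EuclideanSpace ℝ (Fin n))
    (h0 : (0 : EuclideanSpace ℝ (Fin n)) ∈ LimitingSubdiff f xb)
    (hpr : ProxRegularAt f xb 0) (hsc : SubdiffContAt f xb 0) :
    List.TFAE [
      ((∃ κ : ℝ, 0 < κ ∧
          MetricallyRegularAround (LimitingSubdiff f) xb (0 : EuclideanSpace ℝ (Fin n)) κ) ∧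
        ∀ u w : EuclideanSpace ℝ (Fin n), w ∈ SecondSubdiff f xb 0 u → u ≠ 0 → 0 ≤ ⟪w, u⟫),
      ((∃ κ : ℝ, 0 < κ ∧
          StronglyMetricallyRegularAround (LimitingSubdiff f) xb
            (0 : EuclideanSpace ℝ (Fin n)) κ) ∧
        ∃ U ∈ 𝓝 xb, ∀ x ∈ U, f xb ≤ f x),
      (∀ u w : EuclideanSpace ℝ (Fin n), w ∈ SecondSubdiff f xb 0 u → u ≠ 0 → 0 < ⟪w, u⟫),
      ({u : EuclideanSpace ℝ (Fin n) | (0 : EuclideanSpace ℝ (Fin n)) ∈ SecondSubdiff f xb 0 u}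
          = {0} ∧
        ∀ u w : EuclideanSpace ℝ (Fin n), w ∈ SecondSubdiff f xb 0 u → u ≠ 0 → 0 ≤ ⟪w, u⟫),
      TiltStable f xb
    ] := by
  obtain ⟨r, ε, H⟩ := aux_PRS hbot hpr hsc
  have hxb : f xb ≠ ⊤ := hpr.1
  obtain ⟨ρ, P, D⟩ := aux_prox hbot hlsc h0 H
  tfae_have 1 → 4 := by
    rintro ⟨⟨κ, hκ, hmr⟩, hpsd⟩
    refine ⟨?_, hpsd⟩
    ext u
    constructor
    · intro hu
      exact aux_ker hκ hmr u hu
    · intro hu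
      rw [Set.mem_singleton_iff] at hu
      rw [hu]
      exact aux_zero_mem h0
  tfae_have 4 → 5 := by
    rintro ⟨hker, hpsd⟩
    obtain ⟨θ, σ, hθ0, hθ, hσ, hσρ, hc⟩ := aux_contraction H.1 D hker hpsd
    exact aux_tilt_of_contraction hbot hlsc hxb H.1 D hθ0 hθ hσ hσρ hc
  tfae_have 3 → 4 := by
    intro h
    refine ⟨?_, fun u w hw hu => (h u w hw hu).le⟩
    ext u
    constructor
    · intro hu
      by_contra hne
      have := h u 0 hu hne
      rw [inner_zero_left] at this
      exact lt_irrefl _ this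
    · intro hu
      rw [Set.mem_singleton_iff] at hu
      rw [hu]
      exact aux_zero_mem h0
  tfae_have 5 → 3 := by
    intro hT
    obtain ⟨ρ', K, σ, m, TD⟩ := aux_tilt_data hbot hxb H hT
    intro u w hw hu
    have h1 := aux_pd TD u w hw
    have h2 : 0 < σ * ‖u‖ ^ 2 := mul_pos TD.sig_pos (pow_pos (norm_pos_iff.2 hu) 2)
    linarith
  tfae_have 5 → 2 := by
    intro hT
    obtain ⟨ρ', K, σ, m, TD⟩ := aux_tilt_data hbot hxb H hT
    exact ⟨⟨K + 1, by linarith [TD.K_pos], aux_mr TD⟩, aux_locmin_of_tilt hT⟩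
  tfae_have 2 → 5 := by
    rintro ⟨⟨κ, hκ, hs⟩, hloc⟩
    exact aux_tilt_of_strong hbot hlsc hxb h0 hκ hs hloc
  tfae_have 5 → 1 := by
    intro hT
    obtain ⟨ρ', K, σ, m, TD⟩ := aux_tilt_data hbot hxb H hT
    refine ⟨⟨K + 1, by linarith [TD.K_pos], (aux_mr TD).1⟩, ?_⟩
    intro u w hw hu
    have h1 := aux_pd TD u w hw
    have h2 : 0 < σ * ‖u‖ ^ 2 := mul_pos TD.sig_pos (pow_pos (norm_pos_iff.2 hu) 2)
    linarith
  tfae_finish
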